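/- arXiv:2604.02649 — 5 statements merged into one kernel-verified Lean document; each statement's English description precedes it below -/
import Mathlib

section
/- Let γ = !![a,b;c,d] ∈ SL(2,ℝ) be hyperbolic with two real fixed points γ⁻ < 0 < γ⁺, let v ∈ SL(2,ℝ) satisfy v • i = i and lim_{t→+∞} v • (eᵗ i) = a/c in ℂ, and let t_γ ≥ 0 be such that e^{t_γ} i ∈ Axis(γ). Then for every t with 0 ≤ t ≤ t_γ, dist( v • (eᵗ i), eᵗ i ) ≤ 2 ℓ(γ). -/
open UpperHalfPlane Matrix Real Filter Topology
open scoped MatrixGroups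

noncomputable section

namespace BellisFormal

/-- The point `eᵗ i` of the upper half-plane. -/
def vray (t : ℝ) : ℍ := ⟨⟨0, Real.exp t⟩, Real.exp_pos t⟩

/-- Translation length of `γ`. -/
def transLength (γ : SL(2, ℝ)) : ℝ := ⨅ z : ℍ, dist z (γ • z)

/-- `γ` is hyperbolic: `|tr γ| > 2`. -/
def IsHyperbolic (γ : SL(2, ℝ)) : Prop :=
  2 < |Matrix.trace (γ : Matrix (Fin 2) (Fin 2) ℝ)|

/-- Axis of `γ`. -/
def Axis (γ : SL(2, ℝ)) : Set ℍ := {z : ℍ | dist z (γ • z) = transLength γ}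

/-- `x` is a real fixed point of the Möbius map of `γ`. -/
def IsFixedPt (γ : SL(2, ℝ)) (x : ℝ) : Prop :=
  γ 1 0 * x ^ 2 + (γ 1 1 - γ 0 0) * x - γ 0 1 = 0

def IsAttractingFixedPt (γ : SL(2, ℝ)) (x : ℝ) : Prop :=
  IsFixedPt γ x ∧ 1 < (γ 1 0 * x + γ 1 1) ^ 2

def IsRepellingFixedPt (γ : SL(2, ℝ)) (x : ℝ) : Prop :=
  IsFixedPt γ x ∧ (γ 1 0 * x + γ 1 1) ^ 2 < 1

instance : TopologicalSpace SL(2, ℝ) :=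
  TopologicalSpace.induced (fun g => (g : Matrix (Fin 2) (Fin 2) ℝ)) inferInstance

structure IsNestedSequence (γ : ℕ → SL(2, ℝ)) (γp γm : ℕ → ℝ) (t : ℕ → ℝ) : Prop where
  hyperbolic : ∀ n, IsHyperbolic (γ n)
  discrete : DiscreteTopology (Subgroup.closure (Set.range γ) : Subgroup SL(2, ℝ))
  attracting : ∀ n, IsAttractingFixedPt (γ n) (γp n)
  repelling : ∀ n, IsRepellingFixedPt (γ n) (γm n)
  plus_pos : ∀ n, 0 < γp n
  plus_mono : StrictMono γp
  minus_neg : ∀ n, γm n < 0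
  minus_anti : StrictAnti γm
  t_pos : ∀ n, 0 < t n
  axis_meets : ∀ n, ∀ s : ℝ, 0 ≤ s → (vray s ∈ Axis (γ n) ↔ s = t n)
  len_anti : StrictAnti fun n => transLength (γ n)
  len_tendsto : Filter.Tendsto (fun n => transLength (γ n)) Filter.atTop (nhds 0)

/-- geodesic flow matrix -/
def A (t : ℝ) : SL(2, ℝ) :=
  ⟨!![Real.exp (t / 2), 0; 0, Real.exp (-(t / 2))], by
    simp [Matrix.det_fin_two_of, ← Real.exp_add]⟩

/-- horocyclic flow matrix -/
def N (s : ℝ) : SL(2, ℝ) :=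
  ⟨!![1, s; 0, 1], by simp [Matrix.det_fin_two_of]⟩

/-- the distance `d₁` between unit tangent vectors encoded as elements of `SL(2,ℝ)` -/
def d1 (g h : SL(2, ℝ)) : ℝ :=
  dist (g • vray 0) (h • vray 0) + dist (g • vray 1) (h • vray 1)

/-- product `α 0 * α 1 * ⋯ * α n` -/
def seqProd (α : ℕ → SL(2, ℝ)) (n : ℕ) : SL(2, ℝ) :=
  ((List.range (n + 1)).map α).prod


/-- the point `a + y i` of the upper half-plane -/
def mkPt (a y : ℝ) (hy : 0 < y) : ℍ := ⟨⟨a, y⟩, hy⟩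

/-- the Busemann cocycle values `r_n = B_∞(β_n⁻¹ • i, i)` -/
def busR (α : ℕ → SL(2, ℝ)) (n : ℕ) : ℝ :=
  - Real.log (((seqProd α n)⁻¹ • UpperHalfPlane.I).im)



/-- displacement of a point of the imaginary axis under `g` -/
theorem four_sinh_sq (g : SL(2, ℝ)) (t : ℝ) :
    4 * (Real.exp t) ^ 2 * (Real.sinh (dist (vray t) (g • vray t) / 2)) ^ 2
      = (g 1 0 * (Real.exp t) ^ 2 + g 0 1) ^ 2
        + (g 1 1 - g 0 0) ^ 2 * (Real.exp t) ^ 2 := by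
  have hY : 0 < Real.exp t := Real.exp_pos t
  have hdet : g 0 0 * g 1 1 - g 0 1 * g 1 0 = 1 := by
    have := g.det_coe
    rwa [Matrix.det_fin_two] at this
  have hre : (vray t).re = 0 := rfl
  have him : (vray t).im = Real.exp t := rfl
  set Y := Real.exp t with hYdef
  have hcoe : ((vray t : ℍ) : ℂ) = (Y : ℂ) * Complex.I := by
    apply Complex.ext <;> simp [hre, him]
  have hD : 0 < (g 1 0 * Y) ^ 2 + (g 1 1) ^ 2 := by
    by_contra h
    have h1 : g 1 0 * Y = 0 := by nlinarith [sq_nonneg (g 1 0 * Y), sq_nonneg (g 1 1)]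
    have h2 : g 1 1 = 0 := by nlinarith [sq_nonneg (g 1 0 * Y), sq_nonneg (g 1 1)]
    have h3 : g 1 0 = 0 := by
      rcases mul_eq_zero.1 h1 with h | h
      · exact h
      · exact absurd h hY.ne'
    rw [h2, h3] at hdet
    norm_num at hdet
  have hg : ((g • vray t : ℍ) : ℂ)
      = ((g 0 0 : ℂ) * (Y * Complex.I) + g 0 1) / ((g 1 0 : ℂ) * (Y * Complex.I) + g 1 1) := by
    rw [UpperHalfPlane.specialLinearGroup_apply]
    simp [hcoe]
  have hgre : (g • vray t : ℍ).re
      = (g 0 0 * g 1 0 * Y ^ 2 + g 0 1 * g 1 1) / ((g 1 0 * Y) ^ 2 + (g 1 1) ^ 2) := by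
    rw [← UpperHalfPlane.coe_re, hg]
    simp [Complex.div_re, Complex.normSq_apply]
    field_simp
    ring
  have hgim : (g • vray t : ℍ).im = Y / ((g 1 0 * Y) ^ 2 + (g 1 1) ^ 2) := by
    rw [← UpperHalfPlane.coe_im, hg]
    simp [Complex.div_im, Complex.normSq_apply]
    rw [show g 1 1 * g 1 1 + g 1 0 * Y * (g 1 0 * Y) = (g 1 0 * Y) ^ 2 + (g 1 1) ^ 2 by ring,
      ← sub_div]
    congr 1
    linear_combination Y * hdet
  have hcosh := UpperHalfPlane.cosh_dist' (vray t) (g • vray t)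
  have h2 : Real.cosh (dist (vray t) (g • vray t))
      = 1 + 2 * (Real.sinh (dist (vray t) (g • vray t) / 2)) ^ 2 := by
    have h := Real.cosh_two_mul (dist (vray t) (g • vray t) / 2)
    rw [Real.cosh_sq, mul_div_cancel₀ _ (two_ne_zero)] at h
    linarith
  rw [h2, hre, him, hgre, hgim] at hcosh
  generalize Real.sinh (dist (vray t) (g • vray t) / 2) = S at *
  generalize g 0 0 = a at *
  generalize g 0 1 = b at *
  generalize g 1 0 = c at *
  generalize g 1 1 = d at *
  have hid : (a * c * Y ^ 2 + b * d) ^ 2 + Y ^ 2 * ((c * Y) ^ 2 + d ^ 2 - 1) ^ 2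
      = ((c * Y) ^ 2 + d ^ 2) * ((c * Y ^ 2 + b) ^ 2 + (d - a) ^ 2 * Y ^ 2) := by
    rw [← hdet]; ring
  generalize a * c * Y ^ 2 + b * d = M at *
  generalize (c * Y) ^ 2 + d ^ 2 = D at *
  generalize (c * Y ^ 2 + b) ^ 2 + (d - a) ^ 2 * Y ^ 2 = W at *
  field_simp at hcosh
  have hD0 := hD.ne'
  refine mul_left_cancel₀ hD0 ?_
  rw [← hid]
  linear_combination hcosh

set_option maxHeartbeats 1600000 in
theorem winding_close_before
    (γ : SL(2, ℝ)) (hγ : IsHyperbolic γ)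
    (xm xp : ℝ) (hfm : IsFixedPt γ xm) (hfp : IsFixedPt γ xp)
    (hm : xm < 0) (hp : 0 < xp) (hc : γ 1 0 ≠ 0)
    (v : SL(2, ℝ)) (hv0 : v • (UpperHalfPlane.I : ℍ) = UpperHalfPlane.I)
    (hvend : Tendsto (fun t : ℝ => ((v • vray t : ℍ) : ℂ)) atTop
      (nhds ((γ 0 0 / γ 1 0 : ℝ) : ℂ)))
    (tγ : ℝ) (htγ : 0 ≤ tγ) (haxis : vray tγ ∈ Axis γ) :
    ∀ t : ℝ, 0 ≤ t → t ≤ tγ →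
      dist (v • vray t : ℍ) (vray t) ≤ 2 * transLength γ := by
  intro t ht0 ht
  have hdetv : v 0 0 * v 1 1 - v 0 1 * v 1 0 = 1 := by
    have := v.det_coe
    rwa [Matrix.det_fin_two] at this
  have hdet : γ 0 0 * γ 1 1 - γ 0 1 * γ 1 0 = 1 := by
    have := γ.det_coe
    rwa [Matrix.det_fin_two] at this
  -- `v` is a rotation
  have hv := four_sinh_sq v 0
  have hI : vray 0 = UpperHalfPlane.I := by
    apply UpperHalfPlane.ext
    apply Complex.ext <;> simp [vray, UpperHalfPlane.I]
  rw [hI, hv0] at hv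
  simp at hv
  have hv1 : v 0 1 = - v 1 0 := by nlinarith [sq_nonneg (v 1 0 + v 0 1), sq_nonneg (v 1 1 - v 0 0)]
  have hv2 : v 1 1 = v 0 0 := by nlinarith [sq_nonneg (v 1 0 + v 0 1), sq_nonneg (v 1 1 - v 0 0)]
  have hvt := four_sinh_sq v t
  have hγt := four_sinh_sq γ tγ
  have hax : dist (vray tγ) (γ • vray tγ) = transLength γ := haxis
  rw [hax] at hγt
  have hpq : (v 0 0) ^ 2 + (v 1 0) ^ 2 = 1 := by
    rw [hv1, hv2] at hdetv; linarith
  have hend : (v 1 0 * γ 0 0) ^ 2 ≤ (γ 1 0) ^ 2 := by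
    by_cases hq : v 1 0 = 0
    · rw [hq]; nlinarith [sq_nonneg (γ 1 0)]
    have hlim : Tendsto (fun t : ℝ => ((v • vray t : ℍ) : ℂ)) atTop
        (nhds (((v 0 0 : ℂ) * Complex.I + v 0 1 * (0:ℝ)) / ((v 1 0 : ℂ) * Complex.I + v 1 1 * (0:ℝ)))) := by
      have hE : Tendsto (fun t : ℝ => ((Real.exp (-t) : ℝ) : ℂ)) atTop (nhds ((0:ℝ) : ℂ)) :=
        (Complex.continuous_ofReal.tendsto 0).comp Real.tendsto_exp_neg_atTop_nhds_zero
      have := Tendsto.div (tendsto_const_nhds (x := (v 0 0 : ℂ) * Complex.I) |>.add (hE.const_mul (v 0 1 : ℂ)))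
        (tendsto_const_nhds (x := (v 1 0 : ℂ) * Complex.I) |>.add (hE.const_mul (v 1 1 : ℂ)))
        (by simp [hq])
      refine this.congr fun s => ?_
      have hcoe : ((vray s : ℍ) : ℂ) = ((Real.exp s : ℝ) : ℂ) * Complex.I := by
        apply Complex.ext <;> simp [vray, -Complex.ofReal_exp]
      rw [UpperHalfPlane.specialLinearGroup_apply]
      simp only [Pi.div_apply]
      have he : ((Real.exp s : ℝ) : ℂ) ≠ 0 := by exact_mod_cast (Real.exp_pos s).ne'
      have h1 : ((Real.exp s : ℝ) : ℂ) * ((Real.exp (-s) : ℝ) : ℂ) = 1 := by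
        rw [← Complex.ofReal_mul, ← Real.exp_add]; simp
      simp only [hcoe]
      rw [← mul_div_mul_left _ _ he]
      congr 1
      · linear_combination (v 0 1 : ℂ) * h1
      · linear_combination (v 1 1 : ℂ) * h1
    have huniq := tendsto_nhds_unique hvend hlim
    have hx : γ 0 0 / γ 1 0 = v 0 0 / v 1 0 := by
      have : ((γ 0 0 / γ 1 0 : ℝ) : ℂ) = ((v 0 0 / v 1 0 : ℝ) : ℂ) := by
        rw [huniq]
        have : (v 1 0 : ℂ) ≠ 0 := by exact_mod_cast hq
        push_cast
        field_simp
        simp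
        ring
      exact_mod_cast this
    rw [div_eq_div_iff hc hq] at hx
    have : v 1 0 * γ 0 0 = v 0 0 * γ 1 0 := by linarith
    rw [this]
    nlinarith [mul_nonneg (sq_nonneg (v 1 0)) (sq_nonneg (γ 1 0))]
  have hbc : 0 < γ 0 1 * γ 1 0 := by
    unfold IsFixedPt at hfm hfp
    have h1 : (xp - xm) * (γ 0 1 + γ 1 0 * xm * xp) = 0 := by
      linear_combination xm * hfp - xp * hfm
    have h2 : γ 0 1 = - γ 1 0 * xm * xp := by
      rcases mul_eq_zero.1 h1 with h | h
      · linarith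
      · linarith
    rw [h2]
    have : 0 < (γ 1 0) ^ 2 := by positivity
    nlinarith [mul_pos this (mul_pos (neg_pos.2 hm) hp)]
  have hY1 : 1 ≤ Real.exp t := Real.one_le_exp ht0
  have hYY : Real.exp t ≤ Real.exp tγ := Real.exp_le_exp.2 ht
  have hl0 : 0 ≤ transLength γ := hax ▸ dist_nonneg
  rw [dist_comm]
  suffices h : Real.sinh (dist (vray t) (v • vray t) / 2) ≤ Real.sinh (transLength γ) by
    have := Real.sinh_le_sinh.1 h
    linarith
  refine abs_le_of_sq_le_sq' ?_ (Real.sinh_nonneg_iff.2 hl0) |>.2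
  have hdouble : Real.sinh (transLength γ) ^ 2
      = 4 * Real.sinh (transLength γ / 2) ^ 2 * (1 + Real.sinh (transLength γ / 2) ^ 2) := by
    have h := Real.sinh_two_mul (transLength γ / 2)
    rw [mul_div_cancel₀ _ (two_ne_zero)] at h
    rw [h, mul_pow, mul_pow, Real.cosh_sq]; ring
  rw [hdouble]
  rw [hv1, hv2] at hvt
  generalize Real.sinh (dist (vray t) (v • vray t) / 2) = D at *
  generalize Real.sinh (transLength γ / 2) = S at *
  generalize Real.exp t = Y at *
  generalize Real.exp tγ = R at *
  generalize v 1 0 = q at *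
  generalize γ 0 0 = a at *
  generalize γ 0 1 = b at *
  generalize γ 1 0 = c at *
  generalize γ 1 1 = d at *
  have hR : 0 < R := by linarith
  have hD : D ^ 2 ≤ q ^ 2 * R ^ 2 / 4 := by
    have h1 : 4 * Y ^ 2 * D ^ 2 ≤ Y ^ 2 * (q ^ 2 * Y ^ 2) := by
      rw [hvt]
      have : 0 ≤ q ^ 2 * (2 * Y ^ 2 - 1) := mul_nonneg (sq_nonneg q) (by nlinarith)
      nlinarith
    have h2 : 4 * D ^ 2 ≤ q ^ 2 * Y ^ 2 := by
      refine le_of_mul_le_mul_left (a := Y ^ 2) ?_ (by positivity)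
      linarith
    have h3 : q ^ 2 * Y ^ 2 ≤ q ^ 2 * R ^ 2 := by gcongr
    linarith
  have hS1 : c ^ 2 * R ^ 2 / 4 ≤ S ^ 2 := by
    refine le_of_mul_le_mul_left (a := 4 * R ^ 2) ?_ (by positivity)
    rw [hγt]
    have := mul_pos hbc (pow_pos hR 2)
    nlinarith [sq_nonneg b, mul_nonneg (sq_nonneg (d - a)) (sq_nonneg R)]
  have hS2 : (a + d) ^ 2 / 4 ≤ 1 + S ^ 2 := by
    refine le_of_mul_le_mul_left (a := 4 * R ^ 2) ?_ (by positivity)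
    have : 4 * R ^ 2 * (1 + S ^ 2) = 4 * R ^ 2 + ((c * R ^ 2 + b) ^ 2 + (d - a) ^ 2 * R ^ 2) := by
      rw [← hγt]; ring
    rw [this]
    have h4 : (a + d) ^ 2 = (d - a) ^ 2 + 4 + 4 * (b * c) := by linear_combination 4 * hdet
    rw [h4]
    nlinarith [sq_nonneg (c * R ^ 2 - b)]
  have hatr : 1 ≤ a ^ 2 * (a + d) ^ 2 := by
    have : 1 ≤ a * (a + d) := by nlinarith [sq_nonneg a]
    nlinarith
  calc D ^ 2 ≤ q ^ 2 * R ^ 2 / 4 * 1 := by linarith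
    _ ≤ q ^ 2 * R ^ 2 / 4 * (a ^ 2 * (a + d) ^ 2) := by gcongr
    _ = (q * a) ^ 2 * (R ^ 2 * (a + d) ^ 2 / 4) := by ring
    _ ≤ c ^ 2 * (R ^ 2 * (a + d) ^ 2 / 4) := by gcongr
    _ = 4 * (c ^ 2 * R ^ 2 / 4) * ((a + d) ^ 2 / 4) := by ring
    _ ≤ 4 * S ^ 2 * (1 + S ^ 2) := by gcongr

end BellisFormal
end
end

section
/- Let γ = !![a,b;c,d] ∈ SL(2,ℝ) be hyperbolic with two real fixed points γ⁻ < 0 < γ⁺, let v ∈ SL(2,ℝ) satisfy v • i = i and lim_{t→+∞} v • (eᵗ i) = a/c in ℂ, and let t_γ ≥ 0 be such that e^{t_γ} i ∈ Axis(γ). Then for every t ≥ t_γ, dist( v • (eᵗ i), γ • (eᵗ i) ) ≤ 2 ℓ(γ). -/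
open UpperHalfPlane Matrix Real Filter Topology
open scoped MatrixGroups

noncomputable section

namespace BellisFormal

lemma smul_mul_denom (g : SL(2, ℝ)) (z : ℍ) :
    ((g • z : ℍ) : ℂ) * ((g 1 0 : ℝ) * z + (g 1 1 : ℝ)) = (g 0 0 : ℝ) * z + (g 0 1 : ℝ) := by
  have h := UpperHalfPlane.denom_ne_zero (g : GL (Fin 2) ℝ) z
  rw [UpperHalfPlane.coe_specialLinearGroup_apply]
  simp only [UpperHalfPlane.denom] at h
  have h' : (((g 1 0 : ℝ) : ℂ) * z + ((g 1 1 : ℝ) : ℂ)) ≠ 0 := by simpa using h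
  exact div_mul_cancel₀ _ h'

lemma det_eq (g : SL(2, ℝ)) : g 0 0 * g 1 1 - g 0 1 * g 1 0 = 1 := by
  have := g.det_coe
  rwa [Matrix.det_fin_two] at this

lemma cosh_vray (g : SL(2, ℝ)) (t : ℝ) :
    2 * Real.cosh (dist (vray t) (g • vray t)) =
      g 0 0 ^ 2 + g 1 1 ^ 2 + g 0 1 ^ 2 / Real.exp t ^ 2 + g 1 0 ^ 2 * Real.exp t ^ 2 := by
  have hY := Real.exp_pos t
  have hd := det_eq g
  have h := smul_mul_denom g (vray t)
  have hw : 0 < (g • vray t).im := (g • vray t).im_pos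
  have hre := congrArg Complex.re h
  have him := congrArg Complex.im h
  have e1 : ((vray t : ℍ) : ℂ) = ⟨0, Real.exp t⟩ := rfl
  have e2 : (vray t : ℍ).im = Real.exp t := rfl
  rw [UpperHalfPlane.cosh_dist, Complex.dist_eq, Complex.sq_norm, Complex.normSq_apply]
  rw [e1] at hre him
  rw [e1, e2]
  generalize g • vray t = w at *
  generalize Real.exp t = Y at *
  simp at hre him ⊢
  generalize w.im = y at *
  generalize w.re = x at *
  generalize g 0 0 = a at *
  generalize g 0 1 = b at *
  generalize g 1 0 = c at *
  generalize g 1 1 = d at *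
  have hD : 0 < c ^ 2 * Y ^ 2 + d ^ 2 := by
    by_contra hn
    have hc : c = 0 := by
      have : (c * Y) ^ 2 = 0 := by nlinarith [sq_nonneg (c * Y), sq_nonneg d]
      have := pow_eq_zero_iff (two_ne_zero) |>.1 this
      exact (mul_eq_zero.1 this).resolve_right hY.ne'
    have hd0 : d = 0 := by
      have : d ^ 2 = 0 := by nlinarith [sq_nonneg (c * Y), sq_nonneg d]
      exact pow_eq_zero_iff (two_ne_zero) |>.1 this
    subst hc hd0; simp at hd
  have hy : y = Y / (c ^ 2 * Y ^ 2 + d ^ 2) := by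
    rw [eq_div_iff hD.ne']; linear_combination d * him - c * Y * hre + Y * hd
  have hx : x = (b * d + a * c * Y ^ 2) / (c ^ 2 * Y ^ 2 + d ^ 2) := by
    rw [eq_div_iff hD.ne']; linear_combination d * hre + c * Y * him
  have key : (x ^ 2 + y ^ 2) * (c ^ 2 * Y ^ 2 + d ^ 2) = a ^ 2 * Y ^ 2 + b ^ 2 := by
    have : (x ^ 2 + y ^ 2) * (c ^ 2 * Y ^ 2 + d ^ 2) =
      (x * d - y * (c * Y)) ^ 2 + (x * (c * Y) + y * d) ^ 2 := by ring
    rw [this, hre, him]; ring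
  have key2 : y * (c ^ 2 * Y ^ 2 + d ^ 2) = Y := by rw [hy, div_mul_cancel₀ _ hD.ne']
  have key3 : (x ^ 2 + y ^ 2) * Y = (a ^ 2 * Y ^ 2 + b ^ 2) * y := by
    rw [← key]; linear_combination -(x ^ 2 + y ^ 2) * key2
  have q1 : (x ^ 2 + y ^ 2) / (Y * y) = a ^ 2 + b ^ 2 / Y ^ 2 := by
    field_simp
    linear_combination key3
  have q2 : Y / y = c ^ 2 * Y ^ 2 + d ^ 2 := by
    rw [div_eq_iff hw.ne']; linarith
  trans (x ^ 2 + y ^ 2) / (Y * y) + Y / y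
  · field_simp
    ring
  · rw [q1, q2]; ring

lemma core_ineq (a b c d p r k Z : ℝ) (hkpos : 0 < k) (hk1 : 1 ≤ k) (htk : k ≤ Z)
    (hc : c ≠ 0) (hγd : a * d - b * c = 1) (hvd : p * p - -r * r = 1)
    (hlim : r * a = p * c) (hb' : b = k * c) :
    (p * a + r * c) ^ 2 + (p * d - r * b) ^ 2 + (p * b + r * d) ^ 2 / Z ≤
      a ^ 2 + d ^ 2 + b ^ 2 / k + c ^ 2 * k := by
  have hm1 : (p * b + r * d) ^ 2 / Z ≤ (p * b + r * d) ^ 2 / k := by gcongr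
  have s1 : (p * a + r * c) ^ 2 = a ^ 2 + c ^ 2 := by
    linear_combination (a ^ 2 + c ^ 2) * hvd - (r * a - p * c) * hlim
  have s2 : (p * d - r * b) ^ 2 * (a ^ 2 + c ^ 2) = 1 := by
    have : (p * d - r * b) * (p * a + r * c) = 1 := by
      linear_combination (a * d - b * c) * hvd + hγd - (r * d + p * b) * hlim
    rw [← s1, ← mul_pow, this, one_pow]
  have s3 : (p * b + r * d) ^ 2 = b ^ 2 + d ^ 2 - (p * d - r * b) ^ 2 := by
    linear_combination (b ^ 2 + d ^ 2) * hvd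
  rw [s3] at hm1
  rw [s1, s3]
  generalize (p * d - r * b) ^ 2 = U at *
  have hS : 0 < a ^ 2 + c ^ 2 := by positivity
  have hU : U ≤ d ^ 2 + k * c ^ 2 := by
    have : U * (a ^ 2 + c ^ 2) ≤ (d ^ 2 + k * c ^ 2) * (a ^ 2 + c ^ 2) := by
      rw [s2]
      have h1 : a * d = 1 + k * c ^ 2 := by rw [hb'] at hγd; linarith
      have h2 : 0 ≤ k * c ^ 2 := by positivity
      have h3 : 1 ≤ (a * d) ^ 2 := by rw [h1]; nlinarith
      have h4 : 0 ≤ (k * c ^ 2) * (a ^ 2 + c ^ 2) := by positivity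
      have h5 : 0 ≤ d ^ 2 * c ^ 2 := by positivity
      nlinarith
    exact le_of_mul_le_mul_right this hS
  have fin : a ^ 2 + c ^ 2 + U + (b ^ 2 + d ^ 2 - U) / k ≤ a ^ 2 + d ^ 2 + b ^ 2 / k + c ^ 2 * k := by
    have e : a ^ 2 + d ^ 2 + b ^ 2 / k + c ^ 2 * k - (a ^ 2 + c ^ 2 + U + (b ^ 2 + d ^ 2 - U) / k)
      = (k - 1) / k * (d ^ 2 + k * c ^ 2 - U) := by
      field_simp; ring
    have : 0 ≤ (k - 1) / k * (d ^ 2 + k * c ^ 2 - U) :=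
      mul_nonneg (div_nonneg (by linarith) hkpos.le) (by linarith)
    linarith
  linarith

theorem winding_close_after
    (γ : SL(2, ℝ)) (hγ : IsHyperbolic γ)
    (xm xp : ℝ) (hfm : IsFixedPt γ xm) (hfp : IsFixedPt γ xp)
    (hm : xm < 0) (hp : 0 < xp) (hc : γ 1 0 ≠ 0)
    (v : SL(2, ℝ)) (hv0 : v • (UpperHalfPlane.I : ℍ) = UpperHalfPlane.I)
    (hvend : Tendsto (fun t : ℝ => ((v • vray t : ℍ) : ℂ)) atTop
      (nhds ((γ 0 0 / γ 1 0 : ℝ) : ℂ)))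
    (tγ : ℝ) (htγ : 0 ≤ tγ) (haxis : vray tγ ∈ Axis γ) :
    ∀ t : ℝ, tγ ≤ t →
      dist (v • vray t : ℍ) (γ • vray t : ℍ) ≤ 2 * transLength γ := by
  obtain ⟨T, rfl⟩ : ∃ T, T = tγ := ⟨_, rfl⟩
  -- entries of `v`
  have hvd := det_eq v
  have hvI := smul_mul_denom v UpperHalfPlane.I
  rw [hv0] at hvI
  have hq : v 0 1 = - v 1 0 := by
    have := congrArg Complex.re hvI
    simp at this; linarith
  have hs : v 1 1 = v 0 0 := by
    have := congrArg Complex.im hvI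
    simp at this; linarith
  have hlim : v 1 0 * γ 0 0 = v 0 0 * γ 1 0 := by
    have hE : Tendsto (fun t : ℝ => ((Real.exp (-t) : ℝ) : ℂ)) atTop (nhds ((0 : ℝ) : ℂ)) :=
      (Complex.continuous_ofReal.tendsto _).comp Real.tendsto_exp_neg_atTop_nhds_zero
    have h1 := hvend.mul (((hE.const_mul ((v 1 1 : ℝ) : ℂ)).const_add
      (((v 1 0 : ℝ) : ℂ) * Complex.I)))
    have h2 := (hE.const_mul ((v 0 1 : ℝ) : ℂ)).const_add (((v 0 0 : ℝ) : ℂ) * Complex.I)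
    have h3 := tendsto_nhds_unique (h1.congr (fun t => ?_)) h2
    · have := congrArg Complex.im h3
      simp at this
      field_simp at this
      linarith
    · have h := smul_mul_denom v (vray t)
      have e1 : ((vray t : ℍ) : ℂ) = (Real.exp t : ℝ) * Complex.I := by
        apply Complex.ext <;> simp [vray, -Complex.ofReal_exp]
      have e2 : ((Real.exp t : ℝ) : ℂ) * (Real.exp (-t) : ℝ) = 1 := by
        rw [← Complex.ofReal_mul, ← Real.exp_add]; simp
      generalize ((v • vray t : ℍ) : ℂ) = w at *
      rw [e1] at h
      linear_combination ((Real.exp (-t) : ℝ) : ℂ) * h +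
        (((v 0 0 : ℝ) : ℂ) - w * ((v 1 0 : ℝ) : ℂ)) * Complex.I * e2
  -- fixed points
  have hγd := det_eq γ
  have hb : γ 0 1 = - γ 1 0 * (xm * xp) := by
    unfold IsFixedPt at hfm hfp
    apply mul_left_cancel₀ (sub_ne_zero.2 (hm.trans hp).ne')
    linear_combination xm * hfp - xp * hfm
  set k : ℝ := - (xm * xp) with hk
  have hkpos : 0 < k := by nlinarith
  have hb' : γ 0 1 = k * γ 1 0 := by rw [hb, hk]; ring
  have hbdd : BddBelow (Set.range fun z : ℍ => dist z (γ • z)) :=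
    ⟨0, by rintro _ ⟨z, rfl⟩; exact dist_nonneg⟩
  have hTl : dist (vray T) (γ • vray T) = transLength γ := haxis
  have hl0 : 0 ≤ transLength γ := hTl ▸ dist_nonneg
  have hTk : Real.exp T ^ 2 = k := by
    have hle : dist (vray T) (γ • vray T) ≤
        dist (vray (Real.log k / 2)) (γ • vray (Real.log k / 2)) := by
      rw [hTl]; exact ciInf_le hbdd _
    have hle' : Real.cosh (dist (vray T) (γ • vray T)) ≤
        Real.cosh (dist (vray (Real.log k / 2)) (γ • vray (Real.log k / 2))) :=
      Real.cosh_le_cosh.2 (by rwa [abs_of_nonneg dist_nonneg, abs_of_nonneg dist_nonneg])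
    have c1 := cosh_vray γ T
    have c2 := cosh_vray γ (Real.log k / 2)
    have e : Real.exp (Real.log k / 2) ^ 2 = k := by
      rw [← Real.exp_nat_mul]
      rw [show ((2 : ℕ) : ℝ) * (Real.log k / 2) = Real.log k by push_cast; ring, Real.exp_log hkpos]
    rw [e] at c2
    have hZ : 0 < Real.exp T ^ 2 := by positivity
    generalize Real.exp T ^ 2 = Z at *
    have h3 : γ 0 1 ^ 2 / Z + γ 1 0 ^ 2 * Z ≤ γ 0 1 ^ 2 / k + γ 1 0 ^ 2 * k := by linarith
    rw [hb'] at h3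
    have h4 : γ 1 0 ^ 2 * (Z - k) ^ 2 ≤ 0 := by
      have : γ 1 0 ^ 2 * (Z - k) ^ 2 = Z * (((k * γ 1 0) ^ 2 / Z + γ 1 0 ^ 2 * Z) -
        ((k * γ 1 0) ^ 2 / k + γ 1 0 ^ 2 * k)) := by field_simp; ring
      rw [this]
      exact mul_nonpos_of_nonneg_of_nonpos hZ.le (by linarith)
    have hc2 : 0 < γ 1 0 ^ 2 := by positivity
    have h5 : (Z - k) ^ 2 = 0 := le_antisymm (by
      by_contra hn
      push Not at hn
      have := mul_pos hc2 hn
      linarith) (sq_nonneg _)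
    have := pow_eq_zero_iff (two_ne_zero) |>.1 h5
    linarith
  have hk1 : 1 ≤ k := by
    rw [← hTk]; exact one_le_pow₀ (Real.one_le_exp htγ)
  intro t ht
  have htk : k ≤ Real.exp t ^ 2 := by
    rw [← hTk]; gcongr
  suffices dist (v • vray t : ℍ) (γ • vray t : ℍ) ≤ transLength γ by linarith
  have hg : dist (v • vray t : ℍ) (γ • vray t : ℍ) =
      dist (vray t) ((v⁻¹ * γ) • vray t) := by
    rw [← dist_smul v (vray t) ((v⁻¹ * γ) • vray t), mul_smul, smul_inv_smul]
  rw [hg, ← hTl]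
  suffices Real.cosh (dist (vray t) ((v⁻¹ * γ) • vray t)) ≤
      Real.cosh (dist (vray T) (γ • vray T)) by
    rwa [Real.cosh_le_cosh, abs_of_nonneg dist_nonneg, abs_of_nonneg dist_nonneg] at this
  have c1 := cosh_vray γ T
  have c2 := cosh_vray (v⁻¹ * γ) t
  have g00 : (v⁻¹ * γ) 0 0 = v 0 0 * γ 0 0 + v 1 0 * γ 1 0 := by
    rw [Matrix.SpecialLinearGroup.coe_mul, Matrix.SpecialLinearGroup.coe_inv, Matrix.adjugate_fin_two]
    simp [Matrix.mul_apply, Fin.sum_univ_two, hq, hs]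
  have g01 : (v⁻¹ * γ) 0 1 = v 0 0 * γ 0 1 + v 1 0 * γ 1 1 := by
    rw [Matrix.SpecialLinearGroup.coe_mul, Matrix.SpecialLinearGroup.coe_inv, Matrix.adjugate_fin_two]
    simp [Matrix.mul_apply, Fin.sum_univ_two, hq, hs]
  have g10 : (v⁻¹ * γ) 1 0 = 0 := by
    rw [Matrix.SpecialLinearGroup.coe_mul, Matrix.SpecialLinearGroup.coe_inv, Matrix.adjugate_fin_two]
    simp [Matrix.mul_apply, Fin.sum_univ_two, hq, hs]
    linarith
  have g11 : (v⁻¹ * γ) 1 1 = v 0 0 * γ 1 1 - v 1 0 * γ 0 1 := by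
    rw [Matrix.SpecialLinearGroup.coe_mul, Matrix.SpecialLinearGroup.coe_inv, Matrix.adjugate_fin_two]
    simp [Matrix.mul_apply, Fin.sum_univ_two, hq, hs]
    ring
  rw [g00, g01, g10, g11] at c2
  rw [hTk] at c1
  rw [hq, hs] at hvd
  generalize Real.exp t ^ 2 = Z at *
  generalize v 0 0 = p at *
  generalize v 1 0 = r at *
  generalize γ 0 0 = a at *
  generalize γ 0 1 = b at *
  generalize γ 1 0 = c at *
  generalize γ 1 1 = d at *
  clear_value k
  have := core_ineq a b c d p r k Z hkpos hk1 htk hc hγd hvd hlim hb'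
  simp only [ne_eq, OfNat.ofNat_ne_zero, not_false_eq_true, zero_pow, zero_mul, add_zero] at c2
  linarith

end BellisFormal
end
end

section
/- Let Γ be a discrete, torsion-free subgroup of SL(2,ℝ) not containing −1, let u ∈ SL(2,ℝ), and let (γ_n)_{n≥0} be a sequence of hyperbolic elements of Γ such that for every n the axis Axis(γ_n) meets the geodesic ray {u • (eᵗ i) : t ≥ 0}, and ℓ(γ_n) → 0 as n → ∞. Then there exist a strictly increasing function φ : ℕ → ℕ and signs ε : ℕ → {1, −1} such that the sequence n ↦ u⁻¹ * (γ_{φ(n)})^{ε(n)} * u is a nested sequence. -/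
open UpperHalfPlane Matrix Real Filter Topology
open scoped MatrixGroups

noncomputable section

namespace BellisFormal

lemma mul00 (g h : SL(2, ℝ)) : (g * h) 0 0 = g 0 0 * h 0 0 + g 0 1 * h 1 0 := by
  simp [Matrix.mul_apply, Fin.sum_univ_two]
lemma mul01 (g h : SL(2, ℝ)) : (g * h) 0 1 = g 0 0 * h 0 1 + g 0 1 * h 1 1 := by
  simp [Matrix.mul_apply, Fin.sum_univ_two]
lemma mul10 (g h : SL(2, ℝ)) : (g * h) 1 0 = g 1 0 * h 0 0 + g 1 1 * h 1 0 := by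
  simp [Matrix.mul_apply, Fin.sum_univ_two]
lemma mul11 (g h : SL(2, ℝ)) : (g * h) 1 1 = g 1 0 * h 0 1 + g 1 1 * h 1 1 := by
  simp [Matrix.mul_apply, Fin.sum_univ_two]
lemma inv00 (g : SL(2, ℝ)) : g⁻¹ 0 0 = g 1 1 := by
  simp [Matrix.SpecialLinearGroup.coe_inv, Matrix.adjugate_fin_two]
lemma inv01 (g : SL(2, ℝ)) : g⁻¹ 0 1 = - g 0 1 := by
  simp [Matrix.SpecialLinearGroup.coe_inv, Matrix.adjugate_fin_two]
lemma inv10 (g : SL(2, ℝ)) : g⁻¹ 1 0 = - g 1 0 := by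
  simp [Matrix.SpecialLinearGroup.coe_inv, Matrix.adjugate_fin_two]
lemma inv11 (g : SL(2, ℝ)) : g⁻¹ 1 1 = g 0 0 := by
  simp [Matrix.SpecialLinearGroup.coe_inv, Matrix.adjugate_fin_two]

/-- trace -/
def tr (g : SL(2, ℝ)) : ℝ := g 0 0 + g 1 1

lemma tr_conj (g k : SL(2, ℝ)) : tr (k⁻¹ * g * k) = tr g := by
  have := det_eq k
  simp only [tr, mul00, mul01, mul10, mul11, inv00, inv01, inv10, inv11]
  linear_combination (g 0 0 + g 1 1) * this

lemma tr_inv (g : SL(2, ℝ)) : tr g⁻¹ = tr g := by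
  simp only [tr, inv00, inv11]; ring

lemma isHyp_iff (g : SL(2, ℝ)) : IsHyperbolic g ↔ 4 < tr g ^ 2 := by
  unfold IsHyperbolic tr
  rw [Matrix.trace_fin_two]
  have := sq_lt_sq (a := (2:ℝ)) (b := g 0 0 + g 1 1)
  rw [abs_of_pos (by norm_num : (0:ℝ) < 2)] at this
  rw [← this]; norm_num

/-- `c|z|² + (d-a) Re z - b` -/
def qf (g : SL(2, ℝ)) (z : ℍ) : ℝ :=
  g 1 0 * (z.re ^ 2 + z.im ^ 2) + (g 1 1 - g 0 0) * z.re - g 0 1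

lemma cosh_disp (g : SL(2, ℝ)) (z : ℍ) :
    2 * (Real.cosh (dist z (g • z)) - 1) = (qf g z / z.im) ^ 2 + (tr g ^ 2 - 4) := by
  have hy := z.im_pos
  have hdet := det_eq g
  have hco := coe_specialLinearGroup_apply g z
  simp only [Algebra.algebraMap_self, RingHom.id_apply] at hco
  have hpos : 0 < (g 1 0 * z.re + g 1 1) ^ 2 + (g 1 0 * z.im) ^ 2 := by
    by_cases hc : g 1 0 = 0
    · have : g 1 1 ≠ 0 := by
        intro h; rw [hc, h] at hdet; norm_num at hdet
      rw [hc]; simp; positivity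
    · positivity
  have hre : (g • z).re = ((g 0 0 * z.re + g 0 1) * (g 1 0 * z.re + g 1 1)
      + g 0 0 * g 1 0 * z.im ^ 2) / ((g 1 0 * z.re + g 1 1) ^ 2 + (g 1 0 * z.im) ^ 2) := by
    have := congrArg Complex.re hco
    simp [Complex.div_re, Complex.normSq_apply] at this
    rw [this]; field_simp
  have him : (g • z).im = z.im / ((g 1 0 * z.re + g 1 1) ^ 2 + (g 1 0 * z.im) ^ 2) := by
    have := congrArg Complex.im hco
    simp [Complex.div_im, Complex.normSq_apply] at this
    rw [this, ← sub_div, ← pow_two, ← pow_two]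
    congr 1
    linear_combination z.im * hdet
  rw [UpperHalfPlane.cosh_dist', hre, him, qf, tr]
  generalize g 0 0 = a at *
  generalize g 0 1 = b at *
  generalize g 1 0 = c at *
  generalize g 1 1 = d at *
  generalize z.re = x at *
  generalize z.im = y at *
  have key : (x * ((c * x + d) ^ 2 + (c * y) ^ 2)
        - ((a * x + b) * (c * x + d) + a * c * y ^ 2)) ^ 2
      + y ^ 2 * (((c * x + d) ^ 2 + (c * y) ^ 2) - 1) ^ 2
      = ((c * x + d) ^ 2 + (c * y) ^ 2) *
        ((c * (x ^ 2 + y ^ 2) + (d - a) * x - b) ^ 2 + y ^ 2 * ((a + d) ^ 2 - 4)) := by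
    linear_combination (y ^ 2 * (-2 * ((c * x + d) ^ 2 + (c * y) ^ 2) - 1 - (a * d - b * c))) * hdet
  generalize (c * x + d) ^ 2 + (c * y) ^ 2 = n at *
  generalize (a * x + b) * (c * x + d) + a * c * y ^ 2 = p at *
  generalize c * (x ^ 2 + y ^ 2) + (d - a) * x - b = q at *
  field_simp
  linear_combination key

lemma exists_qf_zero (g : SL(2, ℝ)) (hg : 4 < tr g ^ 2) : ∃ z : ℍ, qf g z = 0 := by
  have hdet := det_eq g
  unfold tr at hg
  by_cases hc : g 1 0 = 0
  · have hne : g 1 1 - g 0 0 ≠ 0 := by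
      intro h
      rw [hc] at hdet
      nlinarith
    refine ⟨⟨⟨g 0 1 / (g 1 1 - g 0 0), 1⟩, by norm_num⟩, ?_⟩
    simp [qf, hc]
    change (g 1 1 - g 0 0) * (g 0 1 / (g 1 1 - g 0 0)) - g 0 1 = 0
    field_simp; ring
  · have hD : 0 < (g 0 0 + g 1 1) ^ 2 - 4 := by linarith
    refine ⟨⟨⟨(g 0 0 - g 1 1) / (2 * g 1 0), √((g 0 0 + g 1 1) ^ 2 - 4) / (2 * |g 1 0|)⟩, ?_⟩, ?_⟩
    · simp only; positivity
    · change g 1 0 * (((g 0 0 - g 1 1) / (2 * g 1 0)) ^ 2 + (√((g 0 0 + g 1 1) ^ 2 - 4) / (2 * |g 1 0|)) ^ 2) + (g 1 1 - g 0 0) * ((g 0 0 - g 1 1) / (2 * g 1 0)) - g 0 1 = 0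
      rw [div_pow _ (2 * |g 1 0|), mul_pow 2 |g 1 0|, sq_abs, Real.sq_sqrt hD.le]
      field_simp
      linear_combination 4 * hdet

lemma transLength_nonneg (g : SL(2, ℝ)) : 0 ≤ transLength g :=
  Real.iInf_nonneg fun _ => dist_nonneg

lemma transLength_eq (g : SL(2, ℝ)) (_hg : 4 < tr g ^ 2) (z : ℍ) (hz : qf g z = 0) :
    transLength g = dist z (g • z) := by
  apply le_antisymm
  · exact ciInf_le ⟨0, by rintro _ ⟨w, rfl⟩; exact dist_nonneg⟩ z
  · apply le_ciInf
    intro w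
    have h1 := cosh_disp g z
    have h2 := cosh_disp g w
    rw [hz, zero_div] at h1
    have : Real.cosh (dist z (g • z)) ≤ Real.cosh (dist w (g • w)) := by
      nlinarith [sq_nonneg (qf g w / w.im)]
    rwa [Real.cosh_le_cosh, abs_of_nonneg dist_nonneg, abs_of_nonneg dist_nonneg] at this

lemma cosh_transLength (g : SL(2, ℝ)) (hg : 4 < tr g ^ 2) :
    2 * (Real.cosh (transLength g) - 1) = tr g ^ 2 - 4 := by
  obtain ⟨z, hz⟩ := exists_qf_zero g hg
  rw [transLength_eq g hg z hz, cosh_disp, hz]; ring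

lemma mem_axis_iff (g : SL(2, ℝ)) (hg : 4 < tr g ^ 2) (z : ℍ) : z ∈ Axis g ↔ qf g z = 0 := by
  constructor
  · intro h
    have h1 := cosh_disp g z
    rw [show dist z (g • z) = transLength g from h, cosh_transLength g hg] at h1
    have : qf g z / z.im = 0 := by
      have : (qf g z / z.im) ^ 2 = 0 := by linarith
      exact pow_eq_zero_iff (by norm_num) |>.1 this
    rcases div_eq_zero_iff.1 this with h | h
    · exact h
    · exact absurd h z.im_pos.ne'
  · intro h
    exact (transLength_eq g hg z h).symm

lemma qf_vray (g : SL(2, ℝ)) (s : ℝ) : qf g (vray s) = g 1 0 * Real.exp (2 * s) - g 0 1 := by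
  have h1 : (vray s).re = 0 := rfl
  have h2 : (vray s).im = Real.exp s := rfl
  rw [qf, h1, h2, two_mul, Real.exp_add]; ring

lemma axis_conj (g u : SL(2, ℝ)) (hg : 4 < tr g ^ 2) (z : ℍ) :
    u • z ∈ Axis g ↔ z ∈ Axis (u⁻¹ * g * u) := by
  have hl : transLength (u⁻¹ * g * u) = transLength g := by
    have h1 := cosh_transLength g hg
    have h2 := cosh_transLength (u⁻¹ * g * u) (by rwa [tr_conj])
    rw [tr_conj, ← h1] at h2
    have : Real.cosh (transLength (u⁻¹ * g * u)) = Real.cosh (transLength g) := by linarith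
    exact Real.cosh_injOn (transLength_nonneg _) (transLength_nonneg _) this
  unfold Axis
  simp only [Set.mem_ofPred_eq, hl]
  have : dist (u • z) (g • u • z) = dist z ((u⁻¹ * g * u) • z) := by
    rw [← dist_smul u z, smul_smul, smul_smul]; congr 2; group
  rw [this]

instance instTop_eq : IsTopologicalGroup SL(2, ℝ) :=
  Matrix.SpecialLinearGroup.topologicalGroup
instance instT2 : T2Space SL(2, ℝ) :=
  inferInstanceAs (T2Space {A : Matrix (Fin 2) (Fin 2) ℝ // A.det = 1})


lemma compact_bdd (C : ℝ) : IsCompact {g : SL(2, ℝ) | ∀ i j, |g i j| ≤ C} := by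
  have hemb : IsClosedEmbedding (fun g : SL(2, ℝ) => (g : Matrix (Fin 2) (Fin 2) ℝ)) := 
    Matrix.SpecialLinearGroup.isClosedEmbedding_val
  have hK : IsCompact (Set.univ.pi fun _ => Set.univ.pi fun _ => Set.Icc (-C) C : Set (Fin 2 → Fin 2 → ℝ)) :=
    isCompact_univ_pi fun _ => isCompact_univ_pi fun _ => isCompact_Icc
  have := hemb.isCompact_preimage (K := (Set.univ.pi fun _ => Set.univ.pi fun _ => Set.Icc (-C) C : Set (Fin 2 → Fin 2 → ℝ))) hK
  convert this using 1
  ext g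
  constructor
  · intro h i _ j _
    exact abs_le.1 (h i j)
  · intro h i j
    exact abs_le.2 (h i trivial j trivial)

lemma finite_bdd (Γ : Subgroup SL(2, ℝ)) (hdisc : DiscreteTopology Γ) (C : ℝ) :
    {g : SL(2, ℝ) | g ∈ Γ ∧ ∀ i j, |g i j| ≤ C}.Finite := by
  have hcl : IsClosed (Γ : Set SL(2, ℝ)) := Subgroup.isClosed_of_discrete
  have h1 : IsCompact ((Γ : Set SL(2, ℝ)) ∩ {g : SL(2, ℝ) | ∀ i j, |g i j| ≤ C}) :=
    (compact_bdd C).inter_left hcl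
  apply h1.finite
  exact (isDiscrete_iff_discreteTopology.mpr hdisc).mono Set.inter_subset_left

lemma discrete_conj (Γ Δ : Subgroup SL(2, ℝ)) (hdisc : DiscreteTopology Γ) (k : SL(2, ℝ))
    (h : ∀ x ∈ Δ, k * x * k⁻¹ ∈ Γ) : DiscreteTopology Δ := by
  refine DiscreteTopology.of_continuous_injective (f := fun x : Δ => (⟨k * x * k⁻¹, h x x.2⟩ : Γ)) ?_ ?_
  · fun_prop
  · intro x y hxy
    simpa using hxy

/-- gap for traces on bounded subsets -/
lemma trace_gap (Γ : Subgroup SL(2, ℝ)) (hdisc : DiscreteTopology Γ) (C : ℝ) :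
    ∃ δ > 0, δ ≤ 1 ∧ ∀ g ∈ Γ, (∀ i j, |g i j| ≤ C) → 4 < tr g ^ 2 → 4 + δ ≤ tr g ^ 2 := by
  have hfin := (finite_bdd Γ hdisc C)
  have hev : ∀ᶠ δ in 𝓝[>] (0:ℝ), ∀ g ∈ {g : SL(2, ℝ) | g ∈ Γ ∧ ∀ i j, |g i j| ≤ C},
      4 < tr g ^ 2 → 4 + δ ≤ tr g ^ 2 := by
    rw [Filter.eventually_all_finite hfin]
    intro g _
    by_cases h : 4 < tr g ^ 2
    · filter_upwards [nhdsWithin_le_nhds (Iic_mem_nhds (sub_pos.2 h))] with δ hδ _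
      have : δ ≤ tr g ^ 2 - 4 := hδ
      linarith
    · exact Filter.Eventually.of_forall fun δ h' => absurd h' h
  have h1 : ∀ᶠ δ in 𝓝[>] (0:ℝ), δ ≤ 1 := nhdsWithin_le_nhds (Iic_mem_nhds one_pos)
  obtain ⟨δ, ⟨hδ, hδ1⟩, hδ0⟩ := ((hev.and h1).and self_mem_nhdsWithin).exists
  exact ⟨δ, hδ0, hδ1, fun g hg hb => hδ g ⟨hg, hb⟩⟩

lemma diag_pow (Γ : Subgroup SL(2, ℝ)) (D : SL(2, ℝ)) (hD : D ∈ Γ) (h01 : D 0 1 = 0)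
    (h10 : D 1 0 = 0) (m : ℤ) :
    ∃ E ∈ Γ, E 0 1 = 0 ∧ E 1 0 = 0 ∧ E 0 0 = D 0 0 ^ m ∧ E 1 1 = (D 0 0 ^ m)⁻¹ := by
  have hdet := det_eq D
  rw [h01] at hdet
  have hne : D 0 0 ≠ 0 := by
    intro h; rw [h] at hdet; norm_num at hdet
  have h11 : D 1 1 = (D 0 0)⁻¹ := by
    field_simp; linarith
  induction m using Int.induction_on with
  | zero => exact ⟨1, Γ.one_mem, by simp⟩
  | succ i ih =>
    obtain ⟨E, hE, e1, e2, e3, e4⟩ := ih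
    refine ⟨E * D, Γ.mul_mem hE hD, ?_, ?_, ?_, ?_⟩
    · rw [mul01, e1, h01]; ring
    · rw [mul10, e2, h10]; ring
    · rw [mul00, e3, e1, zpow_add_one₀ hne]; ring
    · rw [mul11, e4, e2, zpow_add_one₀ hne, h11, mul_inv]; ring
  | pred i ih =>
    obtain ⟨E, hE, e1, e2, e3, e4⟩ := ih
    refine ⟨E * D⁻¹, Γ.mul_mem hE (Γ.inv_mem hD), ?_, ?_, ?_, ?_⟩
    · rw [mul01, e1, inv01, h01]; ring
    · rw [mul10, e2, inv10, h10]; ring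
    · rw [mul00, e3, e1, inv00, zpow_sub_one₀ hne, h11]; ring
    · rw [mul11, e4, e2, inv11, zpow_sub_one₀ hne, mul_inv, inv_inv]; ring

lemma balance (ν b c : ℝ) (hν : 1 < ν) (hbc : |b| * |c| ≤ 1) :
    ∃ m : ℤ, ν ^ m * |b| ≤ ν ∧ (ν ^ m)⁻¹ * |c| ≤ 1 := by
  have hν0 : 0 < ν := by linarith
  by_cases hb : b = 0
  · obtain ⟨m, hm⟩ := pow_unbounded_of_one_lt |c| hν
    refine ⟨m, by rw [hb]; simp; exact hν0.le, ?_⟩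
    rw [zpow_natCast, inv_mul_le_iff₀ (by positivity)]
    linarith
  · obtain ⟨n, h1, h2⟩ := exists_mem_Ico_zpow (abs_pos.2 hb) hν
    have hp : 0 < ν ^ n := by positivity
    refine ⟨-n, ?_, ?_⟩
    · rw [_root_.zpow_neg, inv_mul_le_iff₀ hp, ← zpow_add_one₀ hν0.ne']
      exact h2.le
    · rw [_root_.zpow_neg, inv_inv]
      exact le_trans (mul_le_mul_of_nonneg_right h1 (abs_nonneg c)) hbc

lemma entry_bounds (h : SL(2, ℝ)) (ht : tr h ^ 2 < 5) (hbc : 0 ≤ h 0 1 * h 1 0) :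
    |h 0 0| ≤ 2 ∧ |h 1 1| ≤ 2 ∧ h 0 1 * h 1 0 ≤ 1 := by
  have hdet := det_eq h
  unfold tr at ht
  refine ⟨?_, ?_, ?_⟩
  · apply abs_le_of_sq_le_sq _ (by norm_num)
    nlinarith [sq_nonneg (h 1 1)]
  · apply abs_le_of_sq_le_sq _ (by norm_num)
    nlinarith [sq_nonneg (h 0 0)]
  · nlinarith [sq_nonneg (h 0 0 - h 1 1)]

lemma lemX (Γ : Subgroup SL(2, ℝ)) (hdisc : DiscreteTopology Γ) (D : SL(2, ℝ)) (hD : D ∈ Γ)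
    (h01 : D 0 1 = 0) (h10 : D 1 0 = 0) (hν : 1 < D 0 0 ^ 2) :
    ∃ δ > 0, ∀ h ∈ Γ, 4 < tr h ^ 2 → tr h ^ 2 < 4 + δ → h 0 1 * h 1 0 < 0 := by
  obtain ⟨δ, hδ, hδ1, H⟩ := trace_gap Γ hdisc (2 + D 0 0 ^ 2)
  refine ⟨δ, hδ, fun h hh ht1 ht2 => ?_⟩
  by_contra hbc
  push Not at hbc
  obtain ⟨ha, hd, hbc1⟩ := entry_bounds h (by linarith) hbc
  obtain ⟨m, hm1, hm2⟩ := balance (D 0 0 ^ 2) (h 0 1) (h 1 0) hν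
    (by rw [← abs_mul, abs_of_nonneg hbc]; exact hbc1)
  obtain ⟨E, hE, e1, e2, e3, e4⟩ := diag_pow Γ D hD h01 h10 m
  have hne : D 0 0 ≠ 0 := by intro h; rw [h] at hν; norm_num at hν
  have hep : D 0 0 ^ m ≠ 0 := zpow_ne_zero _ hne
  have hpow : (D 0 0 ^ 2) ^ m = (D 0 0 ^ m) ^ 2 := by
    rw [← zpow_natCast, ← zpow_natCast, ← _root_.zpow_mul, ← _root_.zpow_mul, mul_comm]
  rw [hpow] at hm1 hm2
  have htr := tr_conj h E⁻¹
  rw [inv_inv] at htr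
  have := H (E * h * E⁻¹) (Γ.mul_mem (Γ.mul_mem hE hh) (Γ.inv_mem hE)) ?_ (by rwa [htr])
  · rw [htr] at this; linarith
  · have k00 : (E * h * E⁻¹) 0 0 = h 0 0 := by
      simp only [mul00, mul01, inv00, inv10, e1, e2, e3, e4]; field_simp; ring
    have k11 : (E * h * E⁻¹) 1 1 = h 1 1 := by
      simp only [mul11, mul10, inv01, inv11, e1, e2, e3, e4]; field_simp; ring
    have k01 : (E * h * E⁻¹) 0 1 = (D 0 0 ^ m) ^ 2 * h 0 1 := by
      simp only [mul00, mul01, inv01, inv11, e1, e2, e3, e4]; ring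
    have k10 : (E * h * E⁻¹) 1 0 = ((D 0 0 ^ m) ^ 2)⁻¹ * h 1 0 := by
      simp only [mul10, mul11, inv00, inv10, e1, e2, e3, e4]; field_simp; ring
    intro i j
    fin_cases i <;> fin_cases j
    · change |(E * h * E⁻¹) 0 0| ≤ _
      rw [k00]; linarith
    · change |(E * h * E⁻¹) 0 1| ≤ _
      rw [k01, abs_mul, abs_of_nonneg (sq_nonneg _)]; linarith
    · change |(E * h * E⁻¹) 1 0| ≤ _
      rw [k10, abs_mul, abs_of_nonneg (by positivity)]; linarith
    · change |(E * h * E⁻¹) 1 1| ≤ _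
      rw [k11]; linarith

lemma lemX2 (Γ : Subgroup SL(2, ℝ)) (hdisc : DiscreteTopology Γ) (D : SL(2, ℝ)) (hD : D ∈ Γ)
    (h01 : D 0 1 = 0) (h10 : D 1 0 = 0) (ht : 4 < tr D ^ 2) :
    ∃ δ > 0, ∀ h ∈ Γ, 4 < tr h ^ 2 → tr h ^ 2 < 4 + δ → h 0 1 * h 1 0 < 0 := by
  have hdet := det_eq D
  rw [h01] at hdet
  by_cases h1 : 1 < D 0 0 ^ 2
  · exact lemX Γ hdisc D hD h01 h10 h1
  · refine lemX Γ hdisc D⁻¹ (Γ.inv_mem hD) (by rw [inv01, h01]; simp) (by rw [inv10, h10]; simp) ?_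
    rw [inv00]
    unfold tr at ht
    nlinarith

/-- the quadratic polynomial of fixed points -/
def Q (g : SL(2, ℝ)) (x : ℝ) : ℝ := g 1 0 * x ^ 2 + (g 1 1 - g 0 0) * x - g 0 1

lemma lemX3 (Γ : Subgroup SL(2, ℝ)) (hdisc : DiscreteTopology Γ) (g : SL(2, ℝ)) (hg : g ∈ Γ)
    (ht : 4 < tr g ^ 2) (P M : ℝ) (hMP : M < P) (hP : Q g P = 0) (hM : Q g M = 0) :
    ∃ δ > 0, ∀ h ∈ Γ, 4 < tr h ^ 2 → tr h ^ 2 < 4 + δ → 0 < Q h P * Q h M := by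
  set r := √(P - M) with hr
  have hPM : 0 < P - M := by linarith
  have hr0 : 0 < r := Real.sqrt_pos.2 hPM
  have hr2 : r ^ 2 = P - M := Real.sq_sqrt hPM.le
  let k : SL(2, ℝ) := ⟨!![P / r, M / r; 1 / r, 1 / r], by
    rw [Matrix.det_fin_two_of]; field_simp; linarith⟩
  have k00 : k 0 0 = P / r := rfl
  have k01 : k 0 1 = M / r := rfl
  have k10 : k 1 0 = 1 / r := rfl
  have k11 : k 1 1 = 1 / r := rfl
  have c01 : ∀ h : SL(2, ℝ), (k⁻¹ * h * k) 0 1 = - Q h M / (P - M) := by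
    intro h
    simp only [mul00, mul01, inv00, inv01, k00, k01, k10, k11, Q, ← hr2]; field_simp; ring
  have c10 : ∀ h : SL(2, ℝ), (k⁻¹ * h * k) 1 0 = Q h P / (P - M) := by
    intro h
    simp only [mul10, mul11, inv10, inv11, k00, k01, k10, k11, Q, ← hr2]; field_simp; ring
  have hmem : ∀ h ∈ Γ, k⁻¹ * h * k ∈ Γ.map (MulAut.conj k⁻¹).toMonoidHom := by
    intro h hh
    exact ⟨h, hh, by simp⟩
  have hd' : DiscreteTopology (Γ.map (MulAut.conj k⁻¹).toMonoidHom) := by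
    apply discrete_conj Γ _ hdisc k
    rintro _ ⟨x, hx, rfl⟩
    simpa [mul_assoc] using hx
  obtain ⟨δ, hδ, H⟩ := lemX2 _ hd' (k⁻¹ * g * k) (hmem g hg) (by rw [c01, hM]; simp)
    (by rw [c10, hP]; simp) (by rwa [tr_conj])
  refine ⟨δ, hδ, fun h hh h1 h2 => ?_⟩
  have := H (k⁻¹ * h * k) (hmem h hh) (by rwa [tr_conj]) (by rwa [tr_conj])
  rw [c01, c10, div_mul_div_comm, div_lt_iff₀ (by positivity)] at this
  linarith

lemma lemY (Γ : Subgroup SL(2, ℝ)) (hdisc : DiscreteTopology Γ) (T : ℝ) :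
    ∃ δ > 0, ∀ h ∈ Γ, 4 < tr h ^ 2 → tr h ^ 2 < 4 + δ → ∀ s, 0 ≤ s →
      h 1 0 * Real.exp (2 * s) = h 0 1 → T < s := by
  obtain ⟨δ, hδ, hδ1, H⟩ := trace_gap Γ hdisc (2 + Real.exp (2 * T))
  refine ⟨δ, hδ, fun h hh ht1 ht2 s hs hb => ?_⟩
  by_contra hsT
  push Not at hsT
  have he1 : 1 ≤ Real.exp (2 * s) := Real.one_le_exp (by linarith)
  have he2 : Real.exp (2 * s) ≤ Real.exp (2 * T) := Real.exp_le_exp.2 (by linarith)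
  generalize Real.exp (2 * s) = y at *
  generalize Real.exp (2 * T) = Y at *
  have hbc : 0 ≤ h 0 1 * h 1 0 := by rw [← hb]; nlinarith [sq_nonneg (h 1 0)]
  obtain ⟨ha, hd, hbc1⟩ := entry_bounds h (by linarith) hbc
  have hc1 : |h 1 0| ≤ 1 := by
    apply abs_le_of_sq_le_sq _ (by norm_num)
    rw [← hb] at hbc1; nlinarith [sq_nonneg (h 1 0)]
  have hb1 : |h 0 1| ≤ Y := by
    rw [← hb, abs_mul, abs_of_nonneg (by linarith : 0 ≤ y)]
    nlinarith [abs_nonneg (h 1 0)]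
  have := H h hh ?_ ht1
  · linarith
  · intro i j
    fin_cases i <;> fin_cases j
    · change |h 0 0| ≤ _
      linarith
    · change |h 0 1| ≤ _
      linarith
    · change |h 1 0| ≤ _
      linarith
    · change |h 1 1| ≤ _
      linarith

/-- data of one element -/
lemma element_data (h : SL(2, ℝ)) (ht : 4 < tr h ^ 2) (s : ℝ) (hc : h 1 0 ≠ 0)
    (hb : h 1 0 * Real.exp (2 * s) = h 0 1) :
    ∃ (ε : ℤ) (P M : ℝ), (ε = 1 ∨ ε = -1) ∧ M < 0 ∧ 0 < P ∧ P * M = - Real.exp (2 * s) ∧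
      (∀ x, Q h x = h 1 0 * ((x - P) * (x - M))) ∧
      IsAttractingFixedPt (h ^ ε) P ∧ IsRepellingFixedPt (h ^ ε) M := by
  have hdet := det_eq h
  have hD : 0 < tr h ^ 2 - 4 := by linarith
  have hr0 := Real.sqrt_pos.2 hD
  have hr2 := Real.sq_sqrt hD.le
  set r := √(tr h ^ 2 - 4) with hr
  clear_value r
  have hy := Real.exp_pos (2 * s)
  generalize Real.exp (2 * s) = y at *
  set P := (h 0 0 - h 1 1) / (2 * h 1 0) + r / (2 * |h 1 0|) with hP
  set M := (h 0 0 - h 1 1) / (2 * h 1 0) - r / (2 * |h 1 0|) with hM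
  have hac : 0 < |h 1 0| := abs_pos.2 hc
  have hMP : M < P := by
    have : 0 < r / (2 * |h 1 0|) := by positivity
    linarith
  have hsum : h 1 0 * (P + M) = h 0 0 - h 1 1 := by
    rw [hP, hM]; field_simp; ring
  have hprod : P * M = -y := by
    have e : P * M = ((h 0 0 - h 1 1) / (2 * h 1 0)) ^ 2 - (r / (2 * |h 1 0|)) ^ 2 := by
      rw [hP, hM]; ring
    rw [e, div_pow r, mul_pow 2 |h 1 0|, sq_abs, hr2]
    unfold tr
    field_simp
    linear_combination (-4) * hdet + 4 * h 1 0 * hb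
  have hM0 : M < 0 := by
    by_contra hcon
    push Not at hcon
    nlinarith
  have hP0 : 0 < P := by
    by_contra hcon
    push Not at hcon
    nlinarith
  have hQ : ∀ x, Q h x = h 1 0 * ((x - P) * (x - M)) := by
    intro x
    unfold Q
    linear_combination x * hsum - h 1 0 * hprod + hb
  have hQP : Q h P = 0 := by rw [hQ]; ring
  have hQM : Q h M = 0 := by rw [hQ]; ring
  have hdiff : h 1 0 * (P - M) = r ∨ h 1 0 * (P - M) = -r := by
    have : P - M = r / |h 1 0| := by rw [hP, hM]; field_simp; ring
    rw [this]
    rcases abs_choice (h 1 0) with h1 | h1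
    · left; rw [h1]; field_simp
    · right; rw [h1]; field_simp
  have hdm : 0 < P - M := by linarith
  have hlm : (h 1 0 * P + h 1 1) * (h 1 0 * M + h 1 1) = 1 := by
    linear_combination h 1 0 ^ 2 * hprod + h 1 1 * hsum + hdet - h 1 0 * hb
  have hlm' : (- h 1 0 * P + h 0 0) * (- h 1 0 * M + h 0 0) = 1 := by
    linear_combination h 1 0 ^ 2 * hprod - h 0 0 * hsum + hdet - h 1 0 * hb
  have hs : (h 1 0 * P + h 1 1) + (h 1 0 * M + h 1 1) = tr h := by
    unfold tr; linear_combination hsum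
  have hs' : (- h 1 0 * P + h 0 0) + (- h 1 0 * M + h 0 0) = tr h := by
    unfold tr; linear_combination -hsum
  have hcore : ∀ l m : ℝ, l * m = 1 → 0 < (l - m) * (l + m) → 1 < l ^ 2 ∧ m ^ 2 < 1 := by
    intro l m h1 h2
    have h3 : m ^ 2 < l ^ 2 := by linarith [show (l - m) * (l + m) = l ^ 2 - m ^ 2 by ring]
    have h4 : l ^ 2 * m ^ 2 = 1 := by rw [← mul_pow, h1]; norm_num
    constructor
    · by_contra hcon
      push Not at hcon
      nlinarith [sq_nonneg m, sq_nonneg l]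
    · by_contra hcon
      push Not at hcon
      nlinarith [sq_nonneg m, sq_nonneg l]
  have htne : tr h ≠ 0 := by intro h0; rw [h0] at ht; norm_num at ht
  rcases lt_or_gt_of_ne (mul_ne_zero hc htne) with hneg | hpos
  · obtain ⟨a1, a2⟩ := hcore _ _ hlm' (by
      rw [hs']; nlinarith)
    refine ⟨-1, P, M, Or.inr rfl, hM0, hP0, hprod, hQ, ⟨?_, ?_⟩, ⟨?_, ?_⟩⟩
    · rw [_root_.zpow_neg_one, IsFixedPt, inv00, inv01, inv10, inv11]
      unfold Q at hQP; linarith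
    · rw [_root_.zpow_neg_one, inv10, inv11]; exact a1
    · rw [_root_.zpow_neg_one, IsFixedPt, inv00, inv01, inv10, inv11]
      unfold Q at hQM; linarith
    · rw [_root_.zpow_neg_one, inv10, inv11]; exact a2
  · obtain ⟨a1, a2⟩ := hcore _ _ hlm (by
      rw [hs]; nlinarith)
    refine ⟨1, P, M, Or.inl rfl, hM0, hP0, hprod, hQ, ⟨?_, ?_⟩, ⟨?_, ?_⟩⟩
    · rw [zpow_one]; exact hQP
    · rw [zpow_one]; exact a1
    · rw [zpow_one]; exact hQM
    · rw [zpow_one]; exact a2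

lemma nested_step {P M P' M' s s' : ℝ} (c : ℝ) (hM : M < 0) (hP : 0 < P) (hM' : M' < 0)
    (hP' : 0 < P') (h1 : P * M = - Real.exp (2 * s)) (h2 : P' * M' = - Real.exp (2 * s'))
    (hs : s < s') (hq : 0 < (c * ((P - P') * (P - M'))) * (c * ((M - P') * (M - M')))) :
    P < P' ∧ M' < M := by
  have he : Real.exp (2 * s) < Real.exp (2 * s') := Real.exp_lt_exp.2 (by linarith)
  have hlt : P' * M' < P * M := by linarith
  have h3 : (P - P') * (M - M') < 0 := by
    by_contra hcon
    push Not at hcon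
    have h4 : 0 ≤ c ^ 2 * ((P - P') * (M - M')) * ((P - M') * (P' - M)) := by
      have : 0 < (P - M') * (P' - M) := mul_pos (by linarith) (by linarith)
      positivity
    nlinarith
  rcases mul_neg_iff.1 h3 with ⟨h5, h6⟩ | ⟨h5, h6⟩
  · exfalso; nlinarith
  · constructor <;> linarith

lemma tr_zpow_sign (h : SL(2, ℝ)) (ε : ℤ) (hε : ε = 1 ∨ ε = -1) : tr (h ^ ε) = tr h := by
  rcases hε with rfl | rfl
  · rw [zpow_one]
  · rw [_root_.zpow_neg_one, tr_inv]

lemma qf_zpow_sign (h : SL(2, ℝ)) (ε : ℤ) (hε : ε = 1 ∨ ε = -1) (z : ℍ) :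
    qf (h ^ ε) z = 0 ↔ qf h z = 0 := by
  rcases hε with rfl | rfl
  · rw [zpow_one]
  · rw [_root_.zpow_neg_one]
    have : qf h⁻¹ z = - qf h z := by
      unfold qf; rw [inv00, inv01, inv10, inv11]; ring
    rw [this, neg_eq_zero]

lemma transLength_lt_iff (g h : SL(2, ℝ)) (hg : 4 < tr g ^ 2) (hh : 4 < tr h ^ 2) :
    transLength g < transLength h ↔ tr g ^ 2 < tr h ^ 2 := by
  have h1 := cosh_transLength g hg
  have h2 := cosh_transLength h hh
  have h3 := Real.cosh_lt_cosh (x := transLength g) (y := transLength h)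
  rw [abs_of_nonneg (transLength_nonneg g), abs_of_nonneg (transLength_nonneg h)] at h3
  rw [← h3]
  constructor <;> intro h <;> linarith

lemma transLength_congr (g h : SL(2, ℝ)) (hg : 4 < tr g ^ 2) (hh : tr h = tr g) :
    transLength h = transLength g := by
  have hh' : 4 < tr h ^ 2 := by rwa [hh]
  apply le_antisymm
  · rw [← not_lt, transLength_lt_iff g h hg hh', hh]; exact lt_irrefl _
  · rw [← not_lt, transLength_lt_iff h g hh' hg, hh]; exact lt_irrefl _

theorem exists_nested_subsequence
    (Γ : Subgroup SL(2, ℝ)) (hdisc : DiscreteTopology Γ)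
    (htf : ∀ γ ∈ Γ, ∀ n : ℕ, 0 < n → γ ^ n = 1 → γ = 1)
    (hneg : (-1 : SL(2, ℝ)) ∉ Γ)
    (u : SL(2, ℝ)) (γ : ℕ → SL(2, ℝ)) (hmem : ∀ n, γ n ∈ Γ)
    (hhyp : ∀ n, IsHyperbolic (γ n))
    (hmeet : ∀ n, ∃ t : ℝ, 0 ≤ t ∧ (u • vray t : ℍ) ∈ Axis (γ n))
    (hlen : Tendsto (fun n => transLength (γ n)) atTop (nhds 0)) :
    ∃ φ : ℕ → ℕ, StrictMono φ ∧ ∃ ε : ℕ → ℤ, (∀ n, ε n = 1 ∨ ε n = -1) ∧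
      ∃ γp γm : ℕ → ℝ, ∃ tax : ℕ → ℝ,
        IsNestedSequence (fun n => u⁻¹ * (γ (φ n)) ^ (ε n) * u) γp γm tax := by
  set h : ℕ → SL(2, ℝ) := fun n => u⁻¹ * γ n * u with hh
  have htγ : ∀ n, 4 < tr (γ n) ^ 2 := fun n => (isHyp_iff _).1 (hhyp n)
  have htrh : ∀ n, tr (h n) = tr (γ n) := fun n => tr_conj _ _
  have ht : ∀ n, 4 < tr (h n) ^ 2 := fun n => by rw [htrh]; exact htγ n
  have htend : Tendsto (fun n => tr (h n) ^ 2) atTop (𝓝 4) := by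
    have h1 : Tendsto (fun n => 2 * (Real.cosh (transLength (γ n)) - 1) + 4) atTop
        (𝓝 (2 * (Real.cosh 0 - 1) + 4)) :=
      ((((Real.continuous_cosh.tendsto 0).comp hlen).sub_const 1).const_mul 2).add_const 4
    rw [Real.cosh_zero] at h1
    have h2 : (fun n => tr (h n) ^ 2) = (fun n => 2 * (Real.cosh (transLength (γ n)) - 1) + 4) := by
      funext n; rw [cosh_transLength _ (htγ n), htrh]; ring
    rw [h2]; convert h1 using 2; norm_num
  have hev : ∀ δ > 0, ∀ᶠ n in atTop, tr (h n) ^ 2 < 4 + δ := fun δ hδ =>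
    htend.eventually_lt_const (by linarith)
  let Γ' := Γ.map (MulAut.conj u⁻¹).toMonoidHom
  have hd' : DiscreteTopology Γ' := by
    apply discrete_conj Γ _ hdisc u
    rintro _ ⟨x, hx, rfl⟩
    simpa [mul_assoc] using hx
  have hmem' : ∀ n, h n ∈ Γ' := fun n => ⟨γ n, hmem n, by simp [hh]⟩
  have hax : ∀ n s, vray s ∈ Axis (h n) ↔ h n 1 0 * Real.exp (2 * s) = h n 0 1 := by
    intro n s
    rw [mem_axis_iff _ (ht n), qf_vray, sub_eq_zero]
  have hmeet' : ∀ n, ∃ s : ℝ, 0 ≤ s ∧ h n 1 0 * Real.exp (2 * s) = h n 0 1 := by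
    intro n
    obtain ⟨t, h0, h1⟩ := hmeet n
    refine ⟨t, h0, ?_⟩
    rw [← hax]
    exact (axis_conj (γ n) u (htγ n) _).1 h1
  choose s hs0 hs using hmeet'
  obtain ⟨δ0, hδ0, H0⟩ := lemY Γ' hd' 0
  obtain ⟨N0, hN0⟩ := eventually_atTop.1 (hev δ0 hδ0)
  have hspos : ∀ n, N0 ≤ n → 0 < s n := fun n hn =>
    H0 (h n) (hmem' n) (ht n) (hN0 n hn) (s n) (hs0 n) (hs n)
  have hc : ∀ n, N0 ≤ n → h n 1 0 ≠ 0 := by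
    intro n hn hc
    have hb := hs n
    rw [hc, zero_mul] at hb
    exact lt_irrefl _ (H0 (h n) (hmem' n) (ht n) (hN0 n hn) 0 le_rfl (by rw [hc, ← hb]; simp))
  have hdata : ∀ n, ∃ (ε : ℤ) (P M : ℝ), N0 ≤ n →
      ((ε = 1 ∨ ε = -1) ∧ M < 0 ∧ 0 < P ∧ P * M = - Real.exp (2 * s n) ∧
      (∀ x, Q (h n) x = h n 1 0 * ((x - P) * (x - M))) ∧
      IsAttractingFixedPt (h n ^ ε) P ∧ IsRepellingFixedPt (h n ^ ε) M) := by
    intro n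
    by_cases hn : N0 ≤ n
    · obtain ⟨ε, P, M, H⟩ := element_data (h n) (ht n) (s n) (hc n hn) (hs n)
      exact ⟨ε, P, M, fun _ => H⟩
    · exact ⟨1, 0, 0, fun h => absurd h hn⟩
  choose ε P M H using hdata
  have hstep : ∀ m, ∃ n, m < n ∧ (N0 ≤ m →
      (tr (h n) ^ 2 < tr (h m) ^ 2 ∧ P m < P n ∧ M n < M m)) := by
    intro m
    by_cases hm : N0 ≤ m
    · obtain ⟨-, hM, hP, hPM, hQ, -, -⟩ := H m hm
      obtain ⟨δ1, hδ1, H1⟩ := lemX3 Γ' hd' (h m) (hmem' m) (ht m) (P m) (M m) (by linarith)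
        (by rw [hQ]; ring) (by rw [hQ]; ring)
      obtain ⟨δ2, hδ2, H2⟩ := lemY Γ' hd' (s m)
      obtain ⟨n, ⟨⟨⟨hn1, hn2⟩, hn3⟩, hn4⟩⟩ := (((hev δ1 hδ1).and (hev δ2 hδ2)).and
        (hev (tr (h m) ^ 2 - 4) (by linarith [ht m]))).and (eventually_gt_atTop m) |>.exists
      refine ⟨n, hn4, fun _ => ⟨by linarith, ?_⟩⟩
      obtain ⟨-, hM', hP', hPM', hQ', -, -⟩ := H n (by omega)
      have hq := H1 (h n) (hmem' n) (ht n) hn1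
      rw [hQ', hQ'] at hq
      exact nested_step _ hM hP hM' hP' hPM hPM'
        (H2 (h n) (hmem' n) (ht n) hn2 (s n) (hs0 n) (hs n)) hq
    · exact ⟨m + 1, by omega, fun h => absurd h hm⟩
  choose f hf1 hf2 using hstep
  let φ : ℕ → ℕ := fun n => f^[n] N0
  have hφs : ∀ n, φ (n + 1) = f (φ n) := fun n => Function.iterate_succ_apply' f n N0
  have hφm : StrictMono φ := strictMono_nat_of_lt_succ fun n => by rw [hφs]; exact hf1 _
  have hφN : ∀ n, N0 ≤ φ n := fun n => hφm.monotone (Nat.zero_le n)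
  have hconj : ∀ n, u⁻¹ * (γ (φ n)) ^ (ε (φ n)) * u = h (φ n) ^ (ε (φ n)) := by
    intro n
    have := conj_zpow (a := u⁻¹) (b := γ (φ n)) (i := ε (φ n))
    rw [inv_inv] at this
    exact this.symm
  have hsg : ∀ n, ε (φ n) = 1 ∨ ε (φ n) = -1 := fun n => (H _ (hφN n)).1
  have htr' : ∀ n, tr (h (φ n) ^ (ε (φ n))) = tr (h (φ n)) := fun n => tr_zpow_sign _ _ (hsg n)
  have hlen' : ∀ n, transLength (h (φ n) ^ (ε (φ n))) = transLength (γ (φ n)) := fun n =>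
    transLength_congr _ _ (htγ _) (by rw [htr', htrh])
  refine ⟨φ, hφm, fun n => ε (φ n), hsg, fun n => P (φ n), fun n => M (φ n), fun n => s (φ n), ?_⟩
  simp only [hconj]
  refine ⟨?_, ?_, ?_, ?_, ?_, ?_, ?_, ?_, ?_, ?_, ?_, ?_⟩
  · intro n
    rw [isHyp_iff, htr']; exact ht _
  · apply discrete_conj Γ' _ hd' 1
    intro x hx
    simp only [one_mul, inv_one, mul_one]
    refine (Subgroup.closure_le Γ').2 ?_ hx
    rintro _ ⟨n, rfl⟩
    exact Γ'.zpow_mem (hmem' _) _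
  · exact fun n => (H _ (hφN n)).2.2.2.2.2.1
  · exact fun n => (H _ (hφN n)).2.2.2.2.2.2
  · exact fun n => (H _ (hφN n)).2.2.1
  · apply strictMono_nat_of_lt_succ
    intro n
    rw [hφs]; exact (hf2 _ (hφN n)).2.1
  · exact fun n => (H _ (hφN n)).2.1
  · apply strictAnti_nat_of_succ_lt
    intro n
    rw [hφs]; exact (hf2 _ (hφN n)).2.2
  · exact fun n => hspos _ (hφN n)
  · intro n t _
    rw [mem_axis_iff _ (by rw [htr']; exact ht _), qf_zpow_sign _ _ (hsg n),
      ← mem_axis_iff _ (ht _), hax]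
    constructor
    · intro h1
      rw [← hs (φ n)] at h1
      have := Real.exp_injective (mul_left_cancel₀ (hc _ (hφN n)) h1)
      linarith
    · rintro rfl
      exact hs _
  · apply strictAnti_nat_of_succ_lt
    intro n
    rw [hlen', hlen', transLength_lt_iff _ _ (htγ _) (htγ _), ← htrh, ← htrh, hφs]
    exact (hf2 _ (hφN n)).1
  · simp only [hlen']
    exact hlen.comp hφm.tendsto_atTop

end BellisFormal
end
end

section
/- Let (α_n)_{n≥0} be a nested sequence in SL(2,ℝ) with ℓ(α_n) < 2^{−n} for every n ≥ 0, set β_n := α_0 * α_1 * ⋯ * α_n and r_n := − Real.log (Im (β_n⁻¹ • i)). Then the sequence (r_n) converges to a real number. -/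
open UpperHalfPlane Matrix Real Filter Topology
open scoped MatrixGroups

noncomputable section

namespace BellisFormal

lemma im_sl (g : SL(2, ℝ)) (z : ℍ) :
    (g • z).im = z.im / Complex.normSq ((g 1 0 : ℂ) * z + g 1 1) := by
  have e : g • z = (g : GL (Fin 2) ℝ) • z := rfl
  have := UpperHalfPlane.im_smul_eq_div_normSq (g : GL (Fin 2) ℝ) z
  rw [e, this]
  simp [UpperHalfPlane.denom]

lemma disp (g : SL(2, ℝ)) (p q : ℝ) (hp : IsFixedPt g p) (hq : IsFixedPt g (-q))
    (hpq : 0 < p + q) (z : ℍ) :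
    1 + (g 1 0) ^ 2 * (p + q) ^ 2 / 2 ≤ cosh (dist z (g • z)) := by
  unfold IsFixedPt at hp hq
  have h1 : g 0 0 - g 1 1 = g 1 0 * (p - q) := by
    have : (p + q) * (g 0 0 - g 1 1 - g 1 0 * (p - q)) = 0 := by linear_combination hq - hp
    rcases mul_eq_zero.1 this with h | h
    · exact absurd h hpq.ne'
    · linarith
  have h2 : g 0 1 = g 1 0 * (p * q) := by linear_combination -hp - p * h1
  rw [UpperHalfPlane.cosh_dist]
  have hw : ((g • z : ℍ) : ℂ) = ((g 0 0 : ℂ) * z + g 0 1) / ((g 1 0 : ℂ) * z + g 1 1) := by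
    simpa using UpperHalfPlane.coe_specialLinearGroup_apply g z
  have hden : ((g 1 0 : ℂ) * z + g 1 1) ≠ 0 := by
    have := UpperHalfPlane.denom_ne_zero (g : GL (Fin 2) ℝ) z
    simpa [UpperHalfPlane.denom] using this
  have him : (g • z).im = z.im / Complex.normSq ((g 1 0 : ℂ) * z + g 1 1) := by
    exact im_sl g z
  have hN : 0 < Complex.normSq ((g 1 0 : ℂ) * z + g 1 1) := Complex.normSq_pos.2 hden
  have hd : dist (z : ℂ) (g • z : ℍ) ^ 2 * Complex.normSq ((g 1 0 : ℂ) * z + g 1 1)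
      = (g 1 0) ^ 2 * ((z.re - p) ^ 2 + z.im ^ 2) * ((z.re + q) ^ 2 + z.im ^ 2) := by
    rw [Complex.dist_eq, ← Complex.normSq_eq_norm_sq, ← Complex.normSq_mul, hw, sub_mul,
      div_mul_cancel₀ _ hden]
    have : (z : ℂ) * ((g 1 0 : ℂ) * z + g 1 1) - ((g 0 0 : ℂ) * z + g 0 1)
        = (g 1 0 : ℂ) * ((z : ℂ) - p) * ((z : ℂ) + q) := by
      have h1' : (g 0 0 : ℂ) - g 1 1 = g 1 0 * (p - q) := by exact_mod_cast h1
      have h2' : (g 0 1 : ℂ) = g 1 0 * (p * q) := by exact_mod_cast h2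
      linear_combination -(z : ℂ) * h1' - h2'
    rw [this, Complex.normSq_mul, Complex.normSq_mul, Complex.normSq_ofReal,
      Complex.normSq_apply, Complex.normSq_apply]
    simp
    ring
  have hy := z.im_pos
  have key : dist (z : ℂ) (g • z : ℍ) ^ 2 / (2 * z.im * (g • z).im)
      = (g 1 0) ^ 2 * (((z.re - p) ^ 2 + z.im ^ 2) * ((z.re + q) ^ 2 + z.im ^ 2)) / (2 * z.im ^ 2) := by
    rw [him]
    rw [div_eq_div_iff (by positivity) (by positivity)]
    field_simp
    linear_combination hd
  rw [key]
  have : (p + q) ^ 2 * z.im ^ 2 ≤ ((z.re - p) ^ 2 + z.im ^ 2) * ((z.re + q) ^ 2 + z.im ^ 2) := by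
    nlinarith [sq_nonneg ((z.re - p) * (z.re + q) + z.im ^ 2)]
  have h3 := mul_le_mul_of_nonneg_left this (sq_nonneg (g 1 0))
  have : (g 1 0) ^ 2 * (p + q) ^ 2 / 2 ≤ (g 1 0) ^ 2 * (((z.re - p) ^ 2 + z.im ^ 2) * ((z.re + q) ^ 2 + z.im ^ 2)) / (2 * z.im ^ 2) := by
    rw [div_le_div_iff₀ (by norm_num) (by positivity)]
    nlinarith
  linarith

lemma eps_bound (g : SL(2, ℝ)) (p q : ℝ) (hp : IsFixedPt g p) (hq : IsFixedPt g (-q))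
    (hpq : 0 < p + q) (δ : ℝ) (hδ1 : δ ≤ 1) (hl : transLength g < δ) :
    |g 1 0| * (p + q) ≤ 2 * δ := by
  obtain ⟨z, hz⟩ := exists_lt_of_ciInf_lt hl
  have h0 : 0 ≤ dist z (g • z) := dist_nonneg
  have hδ0 : 0 ≤ δ := h0.trans hz.le
  have h1 := disp g p q hp hq hpq z
  have h2 : cosh (dist z (g • z)) ≤ cosh δ := by
    rw [Real.cosh_le_cosh, abs_of_nonneg h0, abs_of_nonneg hδ0]; exact hz.le
  have h3 : cosh δ = 1 + 2 * sinh (δ / 2) ^ 2 := by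
    have := Real.cosh_two_mul (δ / 2)
    rw [Real.cosh_sq] at this
    rw [show 2 * (δ / 2) = δ by ring] at this
    linarith
  have h4 : sinh (δ / 2) ≤ δ := by
    rw [Real.sinh_eq]
    have e1 := abs_le.1 (Real.abs_exp_sub_one_le (x := δ / 2) (by rw [abs_of_nonneg (by linarith)]; linarith))
    have e2 := abs_le.1 (Real.abs_exp_sub_one_le (x := -(δ / 2)) (by rw [abs_neg, abs_of_nonneg (by linarith)]; linarith))
    rw [abs_neg] at e2
    rw [abs_of_nonneg (show 0 ≤ δ / 2 by linarith)] at e1 e2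
    linarith [e1.2, e2.1]
  have h5 : 0 ≤ sinh (δ / 2) := Real.sinh_nonneg_iff.2 (by linarith)
  apply le_of_sq_le_sq _ (by linarith)
  rw [mul_pow, sq_abs]
  nlinarith

/-- entry bounds -/
structure Good (g : SL(2, ℝ)) (D e : ℝ) : Prop where
  a0 : 0 ≤ g 0 0
  b0 : 0 ≤ g 0 1
  c0 : 0 ≤ g 1 0
  d0 : 0 ≤ g 1 1
  a1 : g 0 0 ≤ 1 + e
  a2 : 1 ≤ g 0 0 * (1 + e)
  b1 : g 0 1 ≤ e * D
  c1 : g 1 0 * D ≤ e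
  d1 : g 1 1 ≤ 1 + e

lemma good_core (g : SL(2, ℝ)) (p q : ℝ) (hp : IsFixedPt g p) (hq : IsFixedPt g (-q))
    (hp0 : 0 < p) (hq0 : 0 < q) (e : ℝ) (he : |g 1 0| * (p + q) ≤ e)
    (hl : 1 < g 1 0 * p + g 1 1) : Good g (p + q) e := by
  unfold IsFixedPt at hp hq
  have hdet := Matrix.det_fin_two (g : Matrix (Fin 2) (Fin 2) ℝ)
  rw [g.det_coe] at hdet
  have h1 : g 0 0 - g 1 1 = g 1 0 * (p - q) := by
    have : (p + q) * (g 0 0 - g 1 1 - g 1 0 * (p - q)) = 0 := by linear_combination hq - hp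
    rcases mul_eq_zero.1 this with h | h
    · linarith
    · linarith
  have h2 : g 0 1 = g 1 0 * (p * q) := by linear_combination -hp - p * h1
  suffices H : ∀ a b c d : ℝ, 1 = a * d - b * c → a - d = c * (p - q) → b = c * (p * q) →
      |c| * (p + q) ≤ e → 1 < c * p + d →
      0 ≤ a ∧ 0 ≤ b ∧ 0 ≤ c ∧ 0 ≤ d ∧ a ≤ 1 + e ∧ 1 ≤ a * (1 + e) ∧ b ≤ e * (p + q) ∧
        c * (p + q) ≤ e ∧ d ≤ 1 + e by
    obtain ⟨k1, k2, k3, k4, k5, k6, k7, k8, k9⟩ := H _ _ _ _ hdet h1 h2 he hl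
    exact ⟨k1, k2, k3, k4, k5, k6, k7, k8, k9⟩
  clear hp hq hdet h1 h2 he hl
  intro a b c d hdet h1 h2 he hl
  have hD : 0 < p + q := by linarith
  have hdd : (c * p + d) * (-c * q + d) = 1 := by
    linear_combination -hdet - d * h1 + c * h2
  have hmu : 0 < -c * q + d := by
    by_contra! hc
    nlinarith
  have hmu1 : -c * q + d < 1 := by
    by_contra! hc
    nlinarith
  have hc0 : 0 < c := by
    by_contra! hc
    nlinarith
  rw [abs_of_pos hc0] at he
  have hcp := mul_pos hc0 hp0
  have hcq := mul_pos hc0 hq0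
  have hA : (1:ℝ) ≤ (-c * q + d) * (1 + e) := by
    rw [← hdd, mul_comm]
    apply mul_le_mul_of_nonneg_left _ hmu.le
    linarith
  have he0 : 0 ≤ e := le_trans (by positivity) he
  refine ⟨?_, ?_, ?_, ?_, ?_, ?_, ?_, ?_, ?_⟩
  · linarith
  · rw [h2]; positivity
  · exact hc0.le
  · linarith
  · linarith
  · refine hA.trans (mul_le_mul_of_nonneg_right ?_ (by linarith))
    linarith
  · have := mul_le_mul_of_nonneg_right he hD.le
    rw [h2]
    nlinarith [mul_pos hcp hp0, mul_pos hcq hq0, mul_pos hcp hq0]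
  · exact he
  · linarith

lemma good_exists (g : SL(2, ℝ)) (p q : ℝ) (hp : IsAttractingFixedPt g p)
    (hq : IsRepellingFixedPt g (-q))
    (hp0 : 0 < p) (hq0 : 0 < q) (δ : ℝ) (hδ1 : δ ≤ 1) (hl : transLength g < δ) :
    ∃ g' : SL(2, ℝ), (g' = g ∨ g' = -g) ∧ Good g' (p + q) (2 * δ) := by
  have he := eps_bound g p q hp.1 hq.1 (by linarith) δ hδ1 hl
  rcases lt_or_ge 0 (g 1 0 * p + g 1 1) with h | h
  · refine ⟨g, Or.inl rfl, good_core g p q hp.1 hq.1 hp0 hq0 _ he ?_⟩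
    nlinarith [hp.2]
  · refine ⟨-g, Or.inr rfl, good_core (-g) p q ?_ ?_ hp0 hq0 _ ?_ ?_⟩
    · have := hp.1
      unfold IsFixedPt at *
      simp only [Matrix.SpecialLinearGroup.coe_neg, Matrix.neg_apply]
      linarith
    · have := hq.1
      unfold IsFixedPt at *
      simp only [Matrix.SpecialLinearGroup.coe_neg, Matrix.neg_apply]
      linarith
    · simpa using he
    · simp only [Matrix.SpecialLinearGroup.coe_neg, Matrix.neg_apply]
      nlinarith [hp.2]

lemma rec_conv (a b D e : ℕ → ℝ) (g : ℕ → SL(2, ℝ)) (hg : ∀ n, Good (g n) (D n) (e n))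
    (hD : ∀ n, 0 < D n) (hDm : Monotone D) (he : ∀ n, 0 ≤ e n) (hs : Summable e)
    (ha0 : 0 ≤ a 0) (hb0 : 0 ≤ b 0)
    (ha : ∀ n, a (n + 1) = a n * g (n + 1) 0 0 + b n * g (n + 1) 1 0)
    (hb : ∀ n, b (n + 1) = a n * g (n + 1) 0 1 + b n * g (n + 1) 1 1) :
    ∃ L, Tendsto a atTop (𝓝 L) ∧ (0 < a 0 → 0 < L) := by
  have hpos : ∀ n, 0 ≤ a n ∧ 0 ≤ b n := by
    intro n
    induction n with
    | zero => exact ⟨ha0, hb0⟩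
    | succ n ih =>
      obtain ⟨i1, i2⟩ := ih
      have G := hg (n + 1)
      rw [ha, hb]
      exact ⟨add_nonneg (mul_nonneg i1 G.a0) (mul_nonneg i2 G.c0),
        add_nonneg (mul_nonneg i1 G.b0) (mul_nonneg i2 G.d0)⟩
  have hs' : Summable (fun n => e (n + 1)) := (summable_nat_add_iff 1).2 hs
  set S := ∑' n, e (n + 1) with hS
  have hsum : ∀ n, ∑ k ∈ Finset.range n, e (k + 1) ≤ S := fun n =>
    hs'.sum_le_tsum _ (fun i _ => he _)
  have hbc : ∀ n, b n * g (n + 1) 1 0 ≤ b n / D n * e (n + 1) := by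
    intro n
    have G := hg (n + 1)
    rw [div_mul_eq_mul_div, le_div_iff₀ (hD n), mul_assoc]
    apply mul_le_mul_of_nonneg_left _ (hpos n).2
    exact (mul_le_mul_of_nonneg_left (hDm (Nat.le_succ n)) G.c0).trans G.c1
  have hM : ∀ n, a n + b n / D n ≤ (a 0 + b 0 / D 0) * exp (2 * ∑ k ∈ Finset.range n, e (k + 1)) := by
    intro n
    induction n with
    | zero => simp
    | succ n ih =>
      have G := hg (n + 1)
      obtain ⟨i1, i2⟩ := hpos n
      have hq : 0 ≤ b n / D n := div_nonneg i2 (hD n).le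
      have h1 : a (n + 1) ≤ a n * (1 + e (n + 1)) + b n / D n * e (n + 1) := by
        rw [ha]
        exact add_le_add (mul_le_mul_of_nonneg_left G.a1 i1) (hbc n)
      have h2 : b (n + 1) / D (n + 1) ≤ a n * e (n + 1) + b n / D n * (1 + e (n + 1)) := by
        have j1 : b n / D (n + 1) ≤ b n / D n :=
          div_le_div_of_nonneg_left i2 (hD n) (hDm (Nat.le_succ n))
        have j2 : a n * g (n + 1) 0 1 / D (n + 1) ≤ a n * e (n + 1) := by
          rw [div_le_iff₀ (hD _), mul_assoc]
          exact mul_le_mul_of_nonneg_left G.b1 i1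
        have j3 : b n * g (n + 1) 1 1 / D (n + 1) ≤ b n / D n * (1 + e (n + 1)) := by
          rw [mul_div_right_comm]
          exact mul_le_mul j1 G.d1 G.d0 hq
        rw [hb, add_div]
        exact add_le_add j2 j3
      have h3 : 1 + 2 * e (n + 1) ≤ exp (2 * e (n + 1)) := by
        linarith [Real.add_one_le_exp (2 * e (n + 1))]
      rw [Finset.sum_range_succ, mul_add, exp_add, ← mul_assoc]
      calc a (n + 1) + b (n + 1) / D (n + 1)
          ≤ (a n + b n / D n) * (1 + 2 * e (n + 1)) := by linarith
        _ ≤ _ := mul_le_mul ih h3 (by linarith [he (n + 1)])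
          (mul_nonneg (add_nonneg ha0 (div_nonneg hb0 (hD 0).le)) (exp_pos _).le)
  set M := (a 0 + b 0 / D 0) * exp (2 * S) with hMd
  have hM' : ∀ n, a n + b n / D n ≤ M := fun n => (hM n).trans
    (mul_le_mul_of_nonneg_left (exp_le_exp.2 (by linarith [hsum n]))
      (add_nonneg ha0 (div_nonneg hb0 (hD 0).le)))
  have hC : CauchySeq a := by
    refine cauchySeq_of_dist_le_of_summable (fun n => M * e (n + 1)) ?_ (hs'.mul_left M)
    intro n
    have G := hg (n + 1)
    obtain ⟨i1, i2⟩ := hpos n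
    have hlow : 1 - e (n + 1) ≤ g (n + 1) 0 0 := by
      have := G.a2
      have := he (n + 1)
      by_contra! hcon
      nlinarith
    have k0 := mul_le_mul_of_nonneg_right (hM' n) (he (n + 1))
    have k1 := hbc n
    have k2 := mul_le_mul_of_nonneg_left hlow i1
    have k3 := mul_le_mul_of_nonneg_left G.a1 i1
    have k4 := mul_nonneg i2 G.c0
    have k5 : 0 ≤ b n / D n * e (n + 1) := mul_nonneg (div_nonneg i2 (hD n).le) (he _)
    rw [Real.dist_eq, Nat.succ_eq_add_one, ha, abs_le]
    constructor <;> linarith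
  obtain ⟨L, hL⟩ := cauchySeq_tendsto_of_complete hC
  refine ⟨L, hL, fun hp => ?_⟩
  have hlow : ∀ n, a 0 * exp (-∑ k ∈ Finset.range n, e (k + 1)) ≤ a n := by
    intro n
    induction n with
    | zero => simp
    | succ n ih =>
      have G := hg (n + 1)
      obtain ⟨i1, i2⟩ := hpos n
      rw [Finset.sum_range_succ, neg_add, exp_add, ← mul_assoc]
      have h1 : exp (-e (n + 1)) ≤ g (n + 1) 0 0 := by
        rw [exp_neg, inv_le_iff_one_le_mul₀ (exp_pos _)]
        refine G.a2.trans (mul_le_mul_of_nonneg_left ?_ G.a0)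
        linarith [Real.add_one_le_exp (e (n + 1))]
      have := mul_le_mul ih h1 (exp_pos _).le i1
      rw [ha]
      linarith [mul_nonneg i2 G.c0]
  have : a 0 * exp (-S) ≤ L := ge_of_tendsto' hL fun n =>
    (mul_le_mul_of_nonneg_left (exp_le_exp.2 (by linarith [hsum n])) ha0).trans (hlow n)
  exact lt_of_lt_of_le (mul_pos hp (exp_pos _)) this

lemma seqProd_succ (α : ℕ → SL(2, ℝ)) (n : ℕ) :
    seqProd α (n + 1) = seqProd α n * α (n + 1) := by
  simp [seqProd, List.range_succ, mul_assoc]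

lemma busR_eq (α : ℕ → SL(2, ℝ)) (n : ℕ) :
    busR α n = Real.log ((seqProd α n 0 0) ^ 2 + (seqProd α n 1 0) ^ 2) := by
  unfold busR
  generalize seqProd α n = g
  have := im_sl g⁻¹ UpperHalfPlane.I
  rw [this]
  have h1 : g⁻¹ 1 0 = - g 1 0 := by simp [Matrix.SpecialLinearGroup.SL2_inv_expl]
  have h2 : g⁻¹ 1 1 = g 0 0 := by simp [Matrix.SpecialLinearGroup.SL2_inv_expl]
  rw [h1, h2]
  simp [Complex.normSq_apply]
  ring_nf

theorem winding_times_converge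
    (α : ℕ → SL(2, ℝ)) (γp γm tax : ℕ → ℝ) (h : IsNestedSequence α γp γm tax)
    (hlen : ∀ n : ℕ, transLength (α n) < ((1 : ℝ) / 2) ^ n) :
    ∃ L : ℝ, Tendsto (busR α) atTop (nhds L) := by
  have hE : ∀ n, ∃ g' : SL(2, ℝ), (g' = α n ∨ g' = -α n) ∧
      Good g' (γp n + -γm n) (2 * ((1 : ℝ) / 2) ^ n) := fun n =>
    good_exists (α n) (γp n) (-γm n) (h.attracting n) (by rw [neg_neg]; exact h.repelling n)
      (h.plus_pos n) (by linarith [h.minus_neg n]) _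
      (pow_le_one₀ (by norm_num) (by norm_num)) (hlen n)
  choose g hg hG using hE
  have hprod : ∀ n, seqProd g n = seqProd α n ∨ seqProd g n = -seqProd α n := by
    intro n
    induction n with
    | zero => simpa [seqProd] using hg 0
    | succ n ih =>
      rw [seqProd_succ, seqProd_succ]
      rcases ih with h1 | h1 <;> rcases hg (n + 1) with h2 | h2 <;> rw [h1, h2] <;> simp
  have hbus : ∀ n, busR α n = busR g n := by
    intro n
    rw [busR_eq, busR_eq]
    rcases hprod n with h1 | h1 <;> rw [h1]
    simp
  have hD : ∀ n, 0 < γp n + -γm n := fun n => by linarith [h.plus_pos n, h.minus_neg n]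
  have hDm : Monotone (fun n => γp n + -γm n) := fun i j hij =>
    add_le_add (h.plus_mono.monotone hij) (neg_le_neg (h.minus_anti.antitone hij))
  have hs : Summable (fun n : ℕ => 2 * ((1 : ℝ) / 2) ^ n) := summable_geometric_two.mul_left 2
  have h0 : seqProd g 0 = g 0 := by simp [seqProd]
  have he : ∀ n : ℕ, (0 : ℝ) ≤ 2 * ((1 : ℝ) / 2) ^ n := fun n => by positivity
  obtain ⟨L1, hL1, hp1⟩ := rec_conv (fun n => seqProd g n 0 0) (fun n => seqProd g n 0 1)
    _ _ g hG hD hDm he hs (by simpa [h0] using (hG 0).a0) (by simpa [h0] using (hG 0).b0)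
    (fun n => by simp [seqProd_succ, Matrix.mul_apply, Fin.sum_univ_two])
    (fun n => by simp [seqProd_succ, Matrix.mul_apply, Fin.sum_univ_two])
  obtain ⟨L2, hL2, -⟩ := rec_conv (fun n => seqProd g n 1 0) (fun n => seqProd g n 1 1)
    _ _ g hG hD hDm he hs (by simpa [h0] using (hG 0).c0) (by simpa [h0] using (hG 0).d0)
    (fun n => by simp [seqProd_succ, Matrix.mul_apply, Fin.sum_univ_two])
    (fun n => by simp [seqProd_succ, Matrix.mul_apply, Fin.sum_univ_two])
  have hL1p : 0 < L1 := by
    apply hp1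
    have h1 := (hG 0).a2
    have h2 := (hG 0).a0
    rw [h0]
    rcases h2.lt_or_eq with h3 | h3
    · exact h3
    · rw [← h3] at h1; norm_num at h1
  refine ⟨Real.log (L1 ^ 2 + L2 ^ 2), ?_⟩
  have := ((hL1.pow 2).add (hL2.pow 2)).log (by positivity)
  refine this.congr fun n => ?_
  rw [hbus, busR_eq]

end BellisFormal
end
end

section
/- Let Γ be a discrete, torsion-free subgroup of SL(2,ℝ) not containing −1, and let (α_n)_{n≥0} be a nested sequence all of whose terms lie in Γ and which satisfies ℓ(α_n) ≤ 2^{−(2n+3)} for every n. Set β_n := α_0 * ⋯ * α_n and r_n := − Real.log (Im (β_n⁻¹ • i)), and for each n let v_n ∈ SL(2,ℝ) be a vector with v_n • i = i and forward endpoint lim_{t→+∞} v_n • (eᵗ i) = (β_n)₀₀ / (β_n)₁₀ in ℂ (the image of ∞ under the Möbius map of β_n). Then for every ℓ ∈ ℕ there exists T ≥ 0 such that for every n ∈ ℕ and every t ≥ T, ⨅_{γ ∈ Γ} d₁( v_n * A(r_n + t), γ * A(t) ) ≤ (Σ_{k=0}^{n} 2^{−k}) · 2^{−ℓ}. -/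
open UpperHalfPlane Matrix Real Filter Topology
open scoped MatrixGroups

noncomputable section

namespace BellisFormal

lemma mob (g : SL(2, ℝ)) (z : ℍ) :
    ((g • z : ℍ) : ℂ) = ((g 0 0 : ℂ) * z + (g 0 1 : ℂ)) / ((g 1 0 : ℂ) * z + (g 1 1 : ℂ)) := by
  simpa using coe_specialLinearGroup_apply g z

lemma den_ne (g : SL(2, ℝ)) (z : ℍ) : (g 1 0 : ℂ) * z + (g 1 1 : ℂ) ≠ 0 := by
  have := denom_ne_zero (g : GL (Fin 2) ℝ) z
  simpa [denom] using this

lemma mob_im (g : SL(2, ℝ)) (z : ℍ) :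
    (g • z).im = z.im / ‖(g 1 0 : ℂ) * z + (g 1 1 : ℂ)‖ ^ 2 := by
  rw [← coe_im, mob, Complex.div_im, ← Complex.normSq_eq_norm_sq, ← sub_div]
  congr 1
  simp
  linear_combination z.im * det_eq g

lemma inv_entries (g : SL(2, ℝ)) : g⁻¹ 0 0 = g 1 1 ∧ g⁻¹ 0 1 = - g 0 1 ∧ g⁻¹ 1 0 = - g 1 0 ∧
    g⁻¹ 1 1 = g 0 0 := by
  simp [Matrix.SpecialLinearGroup.SL2_inv_expl]

lemma inv_den_ne (g : SL(2, ℝ)) (z : ℍ) : (g 0 0 : ℂ) - (g 1 0 : ℂ) * z ≠ 0 := by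
  have := den_ne g⁻¹ z
  obtain ⟨h1, h2, h3, h4⟩ := inv_entries g
  rw [h3, h4] at this
  intro h; apply this; push_cast; linear_combination h

lemma mob_inv (g : SL(2, ℝ)) (z : ℍ) :
    ((g⁻¹ • z : ℍ) : ℂ) = ((g 1 1 : ℂ) * z - (g 0 1 : ℂ)) / ((g 0 0 : ℂ) - (g 1 0 : ℂ) * z) := by
  obtain ⟨h1, h2, h3, h4⟩ := inv_entries g
  rw [mob, h1, h2, h3, h4]
  push_cast; congr 1; ring

lemma mob_inv_im (g : SL(2, ℝ)) (z : ℍ) :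
    (g⁻¹ • z).im = z.im / ‖(g 0 0 : ℂ) - (g 1 0 : ℂ) * z‖ ^ 2 := by
  obtain ⟨h1, h2, h3, h4⟩ := inv_entries g
  rw [mob_im, h3, h4]
  congr 3; push_cast; ring

lemma dist_le_of (z w : ℍ) (e : ℝ) (he : ‖(z : ℂ) - w‖ ≤ e * √(z.im * w.im)) :
    dist z w ≤ e := by
  have h1 : dist z w / 2 ≤ sinh (dist z w / 2) := Real.self_le_sinh_iff.2 (by positivity)
  rw [sinh_half_dist, Complex.dist_eq] at h1
  have h3 : 0 < √(z.im * w.im) := Real.sqrt_pos.2 (mul_pos z.im_pos w.im_pos)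
  have h2 : ‖(z : ℂ) - w‖ / (2 * √(z.im * w.im)) ≤ e / 2 := by
    rw [div_le_div_iff₀ (by positivity) (by positivity)]
    linarith
  linarith

/-- coefficients from fixed points -/
lemma coeffs (g : SL(2, ℝ)) (p m : ℝ) (hp : IsFixedPt g p) (hm : IsFixedPt g m) (hpm : m < p) :
    g 0 0 - g 1 1 = g 1 0 * (p + m) ∧ g 0 1 = - (g 1 0 * (p * m)) := by
  unfold IsFixedPt at hp hm
  have h1 : g 0 0 - g 1 1 = g 1 0 * (p + m) := by
    have : (p - m) * (g 0 0 - g 1 1) = (p - m) * (g 1 0 * (p + m)) := by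
      linear_combination hm - hp
    exact mul_left_cancel₀ (by linarith [sub_pos.2 hpm]) this
  exact ⟨h1, by linear_combination - p * h1 - hp⟩

lemma disp_s12 (g : SL(2, ℝ)) (p m : ℝ) (hp : IsFixedPt g p) (hm : IsFixedPt g m) (hpm : m < p)
    (z : ℍ) : sinh (dist z (g • z) / 2) =
      |g 1 0| * (‖(z : ℂ) - p‖ * ‖(z : ℂ) - m‖) / (2 * z.im) := by
  obtain ⟨h1, h2⟩ := coeffs g p m hp hm hpm
  have h := den_ne g z
  have hn : 0 < ‖(g 1 0 : ℂ) * z + (g 1 1 : ℂ)‖ := norm_pos_iff.2 h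
  have e1 : (z : ℂ) - (g • z : ℍ) =
      (g 1 0 : ℂ) * (((z : ℂ) - p) * ((z : ℂ) - m)) / ((g 1 0 : ℂ) * z + (g 1 1 : ℂ)) := by
    rw [mob, eq_div_iff h, sub_mul, div_mul_cancel₀ _ h]
    have h1' : (g 0 0 : ℂ) - g 1 1 = g 1 0 * (p + m) := by exact_mod_cast h1
    have h2' : (g 0 1 : ℂ) = - (g 1 0 * (p * m)) := by exact_mod_cast h2
    linear_combination - (z : ℂ) * h1' - h2'
  have hy := z.im_pos
  have e2 : √(z.im * (g • z).im) = z.im / ‖(g 1 0 : ℂ) * z + (g 1 1 : ℂ)‖ := by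
    rw [mob_im, ← mul_div_assoc, ← sq, ← div_pow, Real.sqrt_sq (by positivity)]
  rw [sinh_half_dist, Complex.dist_eq, e1, e2, norm_div, norm_mul, norm_mul, Complex.norm_real,
    Real.norm_eq_abs]
  generalize ‖(g 1 0 : ℂ) * z + (g 1 1 : ℂ)‖ = D at *
  field_simp

lemma prod_ge (z : ℍ) (p m : ℝ) (hpm : m < p) :
    z.im * (p - m) ≤ ‖(z : ℂ) - p‖ * ‖(z : ℂ) - m‖ := by
  have hy := z.im_pos
  rw [← abs_of_nonneg (by nlinarith : 0 ≤ z.im * (p - m)),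
    ← abs_of_nonneg (by positivity : 0 ≤ ‖(z : ℂ) - p‖ * ‖(z : ℂ) - m‖), ← sq_le_sq, mul_pow,
    mul_pow, ← Complex.normSq_eq_norm_sq, ← Complex.normSq_eq_norm_sq, Complex.normSq_apply,
    Complex.normSq_apply]
  simp
  nlinarith [sq_nonneg ((z.re - p) * (z.re - m) + z.im ^ 2)]

lemma bdd (g : SL(2, ℝ)) : BddBelow (Set.range fun z : ℍ => dist z (g • z)) :=
  ⟨0, by rintro _ ⟨z, rfl⟩; exact dist_nonneg⟩

lemma kappa_le (g : SL(2, ℝ)) (p m : ℝ) (hp : IsFixedPt g p) (hm : IsFixedPt g m) (hpm : m < p) :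
    |g 1 0| * (p - m) ≤ 2 * sinh (transLength g / 2) := by
  have : 2 * arsinh (|g 1 0| * (p - m) / 2) ≤ transLength g := by
    refine le_ciInf fun z => ?_
    have h := disp_s12 g p m hp hm hpm z
    have hy := z.im_pos
    have h2 : |g 1 0| * (p - m) / 2 ≤ sinh (dist z (g • z) / 2) := by
      rw [h, div_le_div_iff₀ (by positivity) (by positivity)]
      have := mul_le_mul_of_nonneg_left (prod_ge z p m hpm) (abs_nonneg (g 1 0))
      linarith
    have h3 := Real.arsinh_le_arsinh.2 h2
    rw [Real.arsinh_sinh] at h3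
    linarith
  have h4 : arsinh (|g 1 0| * (p - m) / 2) ≤ transLength g / 2 := by linarith
  have h5 := Real.sinh_le_sinh.2 h4
  rw [Real.sinh_arsinh] at h5
  linarith

lemma axis_eq (g : SL(2, ℝ)) (p m t : ℝ) (hp : IsFixedPt g p) (hm : IsFixedPt g m)
    (hp0 : 0 < p) (hm0 : m < 0) (hc : g 1 0 ≠ 0) (ht : vray t ∈ Axis g) :
    - (p * m) = Real.exp t ^ 2 := by
  have hpm : m < p := by linarith
  have hP : 0 < - (p * m) := by nlinarith
  set q := √(-(p * m)) with hq
  have hq0 : 0 < q := Real.sqrt_pos.2 hP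
  have hq2 : q ^ 2 = -(p * m) := Real.sq_sqrt hP.le
  let w : ℍ := ⟨⟨0, q⟩, hq0⟩
  have key : ∀ (y : ℝ) (hy : 0 < y), (‖((⟨⟨0, y⟩, hy⟩ : ℍ) : ℂ) - p‖ *
      ‖((⟨⟨0, y⟩, hy⟩ : ℍ) : ℂ) - m‖) ^ 2 = (y * (p - m)) ^ 2 + (y ^ 2 + p * m) ^ 2 := by
    intro y hy
    rw [mul_pow, ← Complex.normSq_eq_norm_sq, ← Complex.normSq_eq_norm_sq, Complex.normSq_apply,
      Complex.normSq_apply]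
    simp
    ring
  have h1 : dist (vray t) (g • vray t) ≤ dist w (g • w) := by
    have h0 : dist (vray t) (g • vray t) = transLength g := ht
    rw [h0]
    exact ciInf_le (bdd g) w
  have h2 : sinh (dist (vray t) (g • vray t) / 2) ≤ sinh (dist w (g • w) / 2) :=
    Real.sinh_le_sinh.2 (by linarith)
  rw [disp_s12 g p m hp hm hpm, disp_s12 g p m hp hm hpm] at h2
  have kw := key q hq0
  rw [hq2] at kw
  have kw' : ‖(w : ℂ) - p‖ * ‖(w : ℂ) - m‖ = q * (p - m) := by
    have : (‖(w : ℂ) - p‖ * ‖(w : ℂ) - m‖) ^ 2 = (q * (p - m)) ^ 2 := by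
      rw [kw]; ring
    exact (pow_left_inj₀ (by positivity) (by nlinarith) two_ne_zero).1 this
  have kt := key (Real.exp t) (Real.exp_pos t)
  change (‖(vray t : ℂ) - p‖ * ‖(vray t : ℂ) - m‖) ^ 2 = _ at kt
  rw [kw'] at h2
  have ew : w.im = q := rfl
  have et : (vray t).im = Real.exp t := rfl
  rw [ew, et] at h2
  have hE := Real.exp_pos t
  have hc' : 0 < |g 1 0| := abs_pos.2 hc
  have hX : 0 ≤ ‖(vray t : ℂ) - p‖ * ‖(vray t : ℂ) - m‖ := by positivity
  generalize ‖(vray t : ℂ) - p‖ * ‖(vray t : ℂ) - m‖ = X at *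
  generalize Real.exp t = E at *
  rw [div_le_div_iff₀ (by positivity) (by positivity)] at h2
  have h3 : X ≤ E * (p - m) := by
    have : (|g 1 0| * (2 * q)) * X ≤ (|g 1 0| * (2 * q)) * (E * (p - m)) := by linarith
    exact le_of_mul_le_mul_left this (by positivity)
  have : X ^ 2 ≤ (E * (p - m)) ^ 2 := pow_le_pow_left₀ hX h3 2
  have h4 : (E ^ 2 + p * m) ^ 2 ≤ 0 := by linarith
  have h5 : E ^ 2 + p * m = 0 := by
    exact pow_eq_zero_iff two_ne_zero |>.1 (le_antisymm h4 (sq_nonneg _))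
  linarith

/-- Working data for one hyperbolic element. -/
structure Data (g : SL(2, ℝ)) (p m k : ℝ) : Prop where
  hp : IsFixedPt g p
  hm : IsFixedPt g m
  hp0 : 0 < p
  hm0 : m < 0
  hk : |g 1 0| * (p - m) ≤ k
  hk1 : k ≤ 17 / 128

lemma Data.k_nonneg {g : SL(2, ℝ)} {p m k : ℝ} (D : Data g p m k) : 0 ≤ k :=
  le_trans (mul_nonneg (abs_nonneg _) (by linarith [D.hp0, D.hm0])) D.hk

lemma Data.a_bounds {g : SL(2, ℝ)} {p m k : ℝ} (D : Data g p m k) :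
    1 - k / 2 ≤ |g 0 0| ∧ |g 0 0| ≤ 1 + k ∧ |g 0 0 ^ 2 - 1| ≤ 2 * k := by
  have hk0 := D.k_nonneg
  obtain ⟨h1, h2⟩ := coeffs g p m D.hp D.hm (by linarith [D.hp0, D.hm0])
  have h3 := det_eq g
  have hk := D.hk
  have hk1 := D.hk1
  have hp0 := D.hp0
  have hm0 := D.hm0
  obtain ⟨a, ha⟩ : ∃ a, a = g 0 0 := ⟨_, rfl⟩
  obtain ⟨b, hb⟩ : ∃ a, a = g 0 1 := ⟨_, rfl⟩
  obtain ⟨c, hc⟩ : ∃ a, a = g 1 0 := ⟨_, rfl⟩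
  obtain ⟨d, hd⟩ : ∃ a, a = g 1 1 := ⟨_, rfl⟩
  simp only [← ha, ← hb, ← hc, ← hd] at h1 h2 h3 hk ⊢
  have e1 : a ^ 2 - 1 = a * (c * (p + m)) + c ^ 2 * (-(p * m)) := by
    rw [← h1]; linear_combination h3 + c * h2
  have e2 : |c * (p + m)| ≤ k := by
    rw [abs_mul]
    refine le_trans (mul_le_mul_of_nonneg_left ?_ (abs_nonneg c)) hk
    rw [abs_le]; constructor <;> linarith
  have e3 : 0 ≤ c ^ 2 * (-(p * m)) := mul_nonneg (sq_nonneg _) (by nlinarith)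
  have e4 : c ^ 2 * (-(p * m)) ≤ k ^ 2 / 4 := by
    have : (|c| * (p - m)) ^ 2 ≤ k ^ 2 :=
      pow_le_pow_left₀ (mul_nonneg (abs_nonneg _) (by linarith)) hk 2
    rw [mul_pow, sq_abs] at this
    nlinarith [mul_nonneg (sq_nonneg c) (sq_nonneg (p + m))]
  have e5 : |a * (c * (p + m))| ≤ |a| * k := by
    rw [abs_mul]; exact mul_le_mul_of_nonneg_left e2 (abs_nonneg a)
  have e6 : a ^ 2 = |a| ^ 2 := (sq_abs a).symm
  obtain ⟨e7, e8⟩ := abs_le.1 e5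
  have hA := abs_nonneg a
  have U : |a| ≤ 1 + k := by
    by_contra hcon
    push Not at hcon
    nlinarith
  refine ⟨?_, U, ?_⟩
  · by_contra hcon
    push Not at hcon
    nlinarith
  · rw [abs_le]; constructor <;> nlinarith

lemma Data.den_lower {g : SL(2, ℝ)} {p m k : ℝ} (D : Data g p m k) (z : ℂ) (hz : ‖z‖ ≤ p - m) :
    1 - 3 * k / 2 ≤ ‖(g 0 0 : ℂ) - (g 1 0 : ℂ) * z‖ := by
  have h := norm_sub_norm_le (g 0 0 : ℂ) ((g 1 0 : ℂ) * z)
  rw [norm_mul, Complex.norm_real, Complex.norm_real, Real.norm_eq_abs, Real.norm_eq_abs] at h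
  have h2 := mul_le_mul_of_nonneg_left hz (abs_nonneg (g 1 0))
  have h3 := D.hk
  have h4 := D.a_bounds.1
  linarith

lemma Data.step {g : SL(2, ℝ)} {p m k : ℝ} (D : Data g p m k) (z : ℍ) (hz : ‖(z : ℂ)‖ ≤ p - m) :
    ‖((g⁻¹ • z : ℍ) : ℂ) - z‖ ≤ 48 / 17 * k * (p - m) := by
  obtain ⟨h1, h2⟩ := coeffs g p m D.hp D.hm (by linarith [D.hp0, D.hm0])
  have hk0 := D.k_nonneg
  have hk1 := D.hk1
  have hd := inv_den_ne g z
  have e1 : ((g⁻¹ • z : ℍ) : ℂ) - z =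
      (g 1 0 : ℂ) * (((z : ℂ) - p) * ((z : ℂ) - m)) / ((g 0 0 : ℂ) - (g 1 0 : ℂ) * z) := by
    rw [mob_inv, eq_div_iff hd, sub_mul, div_mul_cancel₀ _ hd]
    have h1' : (g 0 0 : ℂ) - g 1 1 = g 1 0 * (p + m) := by exact_mod_cast h1
    have h2' : (g 0 1 : ℂ) = - (g 1 0 * (p * m)) := by exact_mod_cast h2
    linear_combination - (z : ℂ) * h1' - h2'
  have hl := D.den_lower z hz
  have hL : 0 < p - m := by linarith [D.hp0, D.hm0]
  have n1 : ‖(z : ℂ) - p‖ ≤ ‖(z : ℂ)‖ + p := by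
    refine (norm_sub_le _ _).trans ?_
    rw [Complex.norm_real, Real.norm_eq_abs, abs_of_pos D.hp0]
  have n2 : ‖(z : ℂ) - m‖ ≤ ‖(z : ℂ)‖ - m := by
    refine (norm_sub_le _ _).trans ?_
    rw [Complex.norm_real, Real.norm_eq_abs, abs_of_neg D.hm0]; linarith
  have n3 : ‖(z : ℂ) - p‖ * ‖(z : ℂ) - m‖ ≤ 9 / 4 * (p - m) ^ 2 := by
    have a1 : ‖(z : ℂ) - p‖ * ‖(z : ℂ) - m‖ ≤ (p - m + p) * (p - m - m) :=
      mul_le_mul (by linarith) (by linarith) (norm_nonneg _) (by linarith [D.hp0])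
    nlinarith [sq_nonneg (p + m)]
  rw [e1, norm_div, norm_mul, norm_mul, Complex.norm_real, Real.norm_eq_abs,
    div_le_iff₀ (norm_pos_iff.2 hd)]
  have n4 : |g 1 0| * (‖(z : ℂ) - p‖ * ‖(z : ℂ) - m‖) ≤ 9 / 4 * k * (p - m) := by
    have a1 := mul_le_mul_of_nonneg_left n3 (abs_nonneg (g 1 0))
    have a2 := mul_le_mul_of_nonneg_right D.hk hL.le
    nlinarith
  refine n4.trans ?_
  have n5 : 0 ≤ k * (p - m) := by positivity
  nlinarith

lemma Data.step_im {g : SL(2, ℝ)} {p m k : ℝ} (D : Data g p m k) (z : ℍ)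
    (hz : ‖(z : ℂ)‖ ≤ p - m) :
    (g⁻¹ • z).im ≤ z.im * (1 + 72 / 17 * k) := by
  have hk0 := D.k_nonneg
  have hk1 := D.hk1
  have hd := inv_den_ne g z
  have hl := D.den_lower z hz
  have hy := z.im_pos
  rw [mob_inv_im, div_le_iff₀ (by have := norm_pos_iff.2 hd; positivity), mul_assoc]
  have h1 : (1 - 3 * k / 2) ^ 2 ≤ ‖(g 0 0 : ℂ) - (g 1 0 : ℂ) * z‖ ^ 2 :=
    pow_le_pow_left₀ (by linarith) hl 2
  have h2 : 1 ≤ (1 + 72 / 17 * k) * (1 - 3 * k / 2) ^ 2 := by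
    nlinarith [mul_nonneg hk0 hk0, mul_nonneg (mul_nonneg hk0 hk0) hk0]
  have h3 : 1 ≤ (1 + 72 / 17 * k) * ‖(g 0 0 : ℂ) - (g 1 0 : ℂ) * z‖ ^ 2 :=
    h2.trans (mul_le_mul_of_nonneg_left h1 (by positivity))
  nlinarith

lemma Data.q_est {g : SL(2, ℝ)} {p m k : ℝ} (D : Data g p m k) (w z : ℂ)
    (hw : ‖w‖ ≤ 4 * (p - m)) (hz : ‖z‖ ≤ p - m) :
    ‖((g 0 0 : ℂ) - (g 1 0 : ℂ) * w) * ((g 0 0 : ℂ) - (g 1 0 : ℂ) * z) - 1‖ ≤ 9 * k := by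
  obtain ⟨-, hu, hs⟩ := D.a_bounds
  have hk0 := D.k_nonneg
  have hk1 := D.hk1
  have e : ((g 0 0 : ℂ) - (g 1 0 : ℂ) * w) * ((g 0 0 : ℂ) - (g 1 0 : ℂ) * z) - 1 =
      ((g 0 0 ^ 2 - 1 : ℝ) : ℂ) - (g 0 0 : ℂ) * ((g 1 0 : ℂ) * w + (g 1 0 : ℂ) * z) +
        ((g 1 0 : ℂ) * w) * ((g 1 0 : ℂ) * z) := by push_cast; ring
  have n1 : ‖(g 1 0 : ℂ) * w‖ ≤ 4 * k := by
    rw [norm_mul, Complex.norm_real, Real.norm_eq_abs]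
    have := mul_le_mul_of_nonneg_left hw (abs_nonneg (g 1 0))
    linarith [D.hk]
  have n2 : ‖(g 1 0 : ℂ) * z‖ ≤ k := by
    rw [norm_mul, Complex.norm_real, Real.norm_eq_abs]
    have := mul_le_mul_of_nonneg_left hz (abs_nonneg (g 1 0))
    linarith [D.hk]
  have n3 : ‖((g 0 0 ^ 2 - 1 : ℝ) : ℂ)‖ ≤ 2 * k := by
    rwa [Complex.norm_real, Real.norm_eq_abs]
  have n4 : ‖(g 0 0 : ℂ) * ((g 1 0 : ℂ) * w + (g 1 0 : ℂ) * z)‖ ≤ (1 + k) * (5 * k) := by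
    rw [norm_mul, Complex.norm_real, Real.norm_eq_abs]
    have := norm_add_le ((g 1 0 : ℂ) * w) ((g 1 0 : ℂ) * z)
    exact mul_le_mul hu (by linarith) (norm_nonneg _) (by linarith)
  have n5 : ‖((g 1 0 : ℂ) * w) * ((g 1 0 : ℂ) * z)‖ ≤ 4 * k * k := by
    rw [norm_mul]
    exact mul_le_mul n1 n2 (norm_nonneg _) (by linarith)
  rw [e]
  refine (norm_add_le _ _).trans ?_
  have := norm_sub_le ((g 0 0 ^ 2 - 1 : ℝ) : ℂ)
    ((g 0 0 : ℂ) * ((g 1 0 : ℂ) * w + (g 1 0 : ℂ) * z))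
  nlinarith

lemma inv_est (q : ℂ) (e : ℝ) (he : e ≤ 1 / 2) (hq : ‖q - 1‖ ≤ e) : ‖1 / q - 1‖ ≤ 2 * e := by
  have h0 : 1 / 2 ≤ ‖q‖ := by
    have := norm_sub_norm_le (1 : ℂ) (1 - q)
    rw [norm_one, norm_sub_rev, sub_sub_cancel] at this
    linarith
  have hq0 : q ≠ 0 := by rintro rfl; norm_num at h0
  have : 1 / q - 1 = (1 - q) / q := by field_simp
  rw [this, norm_div, div_le_iff₀ (by linarith), norm_sub_rev]
  have := norm_nonneg (q - 1)
  nlinarith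

lemma Data.compare {g : SL(2, ℝ)} {p m k : ℝ} (D : Data g p m k) (hk : k ≤ 1 / 18) (z : ℍ)
    (hz : ‖(z : ℂ)‖ ≤ p - m) (hy4 : z.im ≤ 4) (E : ℝ) (hE : 1 ≤ E) (hE0 : 0 < E)
    (hEL : E ≤ 3 * (p - m)) :
    dist (mkPt (g⁻¹ • z).re E hE0) (g⁻¹ • mkPt z.re E hE0) ≤ 324 * k := by
  have hk0 := D.k_nonneg
  set w : ℍ := mkPt z.re E hE0 with hwdef
  have hwre : w.re = z.re := rfl
  have hwim : w.im = E := rfl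
  have hy := z.im_pos
  have hw : ‖(w : ℂ)‖ ≤ 4 * (p - m) := by
    have e : (w : ℂ) = (z.re : ℂ) + (E : ℂ) * Complex.I := by
      apply Complex.ext <;> simp [hwre, hwim]
    have h1 : |z.re| ≤ ‖(z : ℂ)‖ := Complex.abs_re_le_norm z
    rw [e]
    refine (norm_add_le _ _).trans ?_
    rw [norm_mul, Complex.norm_I, Complex.norm_real, Complex.norm_real, Real.norm_eq_abs,
      Real.norm_eq_abs, abs_of_pos hE0]
    linarith
  have hz4 : ‖(z : ℂ)‖ ≤ 4 * (p - m) := by linarith [D.hp0, D.hm0]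
  have q1 := inv_est _ (9 * k) (by linarith) (D.q_est w z hw hz)
  have q2 := inv_est _ (9 * k) (by linarith) (D.q_est z z hz4 hz)
  have dw := inv_den_ne g w
  have dz := inv_den_ne g z
  have hdet : (g 0 0 : ℂ) * g 1 1 - g 0 1 * g 1 0 = 1 := by exact_mod_cast det_eq g
  have e1 : ((g⁻¹ • w : ℍ) : ℂ) - (g⁻¹ • z : ℍ) = ((w : ℂ) - z) *
      (1 / (((g 0 0 : ℂ) - (g 1 0 : ℂ) * w) * ((g 0 0 : ℂ) - (g 1 0 : ℂ) * z))) := by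
    rw [mob_inv, mob_inv, div_sub_div _ _ dw dz, mul_one_div]
    congr 1
    linear_combination ((w : ℂ) - z) * hdet
  have e2 : (w : ℂ) - z = ((E - z.im : ℝ) : ℂ) * Complex.I := by
    apply Complex.ext <;> simp [hwre, hwim]
  have e3 : (mkPt (g⁻¹ • z).re E hE0 : ℂ) = (g⁻¹ • z : ℍ) +
      ((E - (g⁻¹ • z).im : ℝ) : ℂ) * Complex.I := by
    apply Complex.ext <;> simp [mkPt]
  have e4 : (mkPt (g⁻¹ • z).re E hE0 : ℂ) - (g⁻¹ • w : ℍ) =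
      - (((E - z.im : ℝ) : ℂ) * Complex.I *
      (1 / (((g 0 0 : ℂ) - (g 1 0 : ℂ) * w) * ((g 0 0 : ℂ) - (g 1 0 : ℂ) * z)) - 1)) -
      (((g⁻¹ • z).im - z.im : ℝ) : ℂ) * Complex.I := by
    rw [e3]
    rw [e2] at e1
    push_cast at e1 ⊢
    linear_combination - e1
  have y1 : |(g⁻¹ • z).im - z.im| ≤ 18 * k * z.im := by
    have : (g⁻¹ • z).im - z.im = z.im *
        (‖1 / (((g 0 0 : ℂ) - (g 1 0 : ℂ) * z) * ((g 0 0 : ℂ) - (g 1 0 : ℂ) * z))‖ - ‖(1 : ℂ)‖) := by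
      rw [mob_inv_im, norm_div, norm_mul, norm_one]
      ring
    rw [this, abs_mul, abs_of_pos hy]
    have h2 := abs_norm_sub_norm_le
      (1 / (((g 0 0 : ℂ) - (g 1 0 : ℂ) * z) * ((g 0 0 : ℂ) - (g 1 0 : ℂ) * z))) 1
    nlinarith
  have n1 : ‖(mkPt (g⁻¹ • z).re E hE0 : ℂ) - (g⁻¹ • w : ℍ)‖ ≤ 162 * k * E := by
    rw [e4]
    refine (norm_sub_le _ _).trans ?_
    rw [norm_neg, norm_mul, norm_mul, norm_mul, Complex.norm_I, Complex.norm_real,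
      Complex.norm_real, Real.norm_eq_abs, Real.norm_eq_abs, mul_one, mul_one]
    have h1 : |E - z.im| ≤ E + z.im := by rw [abs_le]; constructor <;> linarith
    have h2 := mul_le_mul h1 q1 (norm_nonneg _) (by linarith)
    nlinarith
  apply dist_le_of
  refine n1.trans ?_
  have e5 : (mkPt (g⁻¹ • z).re E hE0).im = E := rfl
  have d1 : 0 < ‖(g 0 0 : ℂ) - (g 1 0 : ℂ) * w‖ := norm_pos_iff.2 dw
  have d2 : ‖(g 0 0 : ℂ) - (g 1 0 : ℂ) * w‖ ≤ 2 := by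
    refine (norm_sub_le _ _).trans ?_
    rw [norm_mul, Complex.norm_real, Complex.norm_real, Real.norm_eq_abs, Real.norm_eq_abs]
    have h1 := mul_le_mul_of_nonneg_left hw (abs_nonneg (g 1 0))
    have h2 := D.a_bounds.2.1
    linarith [D.hk]
  rw [e5, mob_inv_im, hwim, ← mul_div_assoc, ← sq, ← div_pow, Real.sqrt_sq (by positivity)]
  have : E / 2 ≤ E / ‖(g 0 0 : ℂ) - (g 1 0 : ℂ) * w‖ :=
    div_le_div_of_nonneg_left hE0.le d1 d2
  nlinarith

lemma sinh_le_of (x : ℝ) (h0 : 0 ≤ x) (h1 : x ≤ 1) : sinh x ≤ x + x ^ 2 := by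
  have h2 := (abs_le.1 (Real.abs_exp_sub_one_sub_id_le (x := x) (by rwa [abs_of_nonneg h0]))).2
  have h3 := Real.add_one_le_exp (-x)
  rw [Real.sinh_eq]
  nlinarith

/-- orbit of `i` -/
def Zs (α : ℕ → SL(2, ℝ)) : ℕ → ℍ
  | 0 => UpperHalfPlane.I
  | n + 1 => (α n)⁻¹ • Zs α n

lemma seqProd_zero (α : ℕ → SL(2, ℝ)) : seqProd α 0 = α 0 := by
  simp [seqProd]

lemma Zs_eq (α : ℕ → SL(2, ℝ)) (n : ℕ) :
    (seqProd α n)⁻¹ • UpperHalfPlane.I = Zs α (n + 1) := by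
  induction n with
  | zero => rw [seqProd_zero]; rfl
  | succ n ih => rw [seqProd_succ, _root_.mul_inv_rev, mul_smul, ih]; rfl

lemma seqProd_mem (Γ : Subgroup SL(2, ℝ)) (α : ℕ → SL(2, ℝ)) (h : ∀ n, α n ∈ Γ) (n : ℕ) :
    seqProd α n ∈ Γ := by
  induction n with
  | zero => rw [seqProd_zero]; exact h 0
  | succ n ih => rw [seqProd_succ]; exact Γ.mul_mem ih (h _)

lemma c_facts (g : SL(2, ℝ)) (p m : ℝ) (hp : IsAttractingFixedPt g p)
    (hm : IsRepellingFixedPt g m) (hpm : m < p) :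
    g 1 0 ≠ 0 ∧ 0 < g 1 0 * (g 1 0 * p + g 1 1) := by
  obtain ⟨hp, hp1⟩ := hp
  obtain ⟨hm, hm1⟩ := hm
  obtain ⟨h1, h2⟩ := coeffs g p m hp hm hpm
  have h3 := det_eq g
  have e : (g 1 0 * (g 1 0 * p + g 1 1)) * (p - m) = (g 1 0 * p + g 1 1) ^ 2 - 1 := by
    linear_combination - h3 + g 1 1 * h1 - g 1 0 * h2
  have : 0 < g 1 0 * (g 1 0 * p + g 1 1) := by
    by_contra hcon
    push Not at hcon
    nlinarith
  exact ⟨left_ne_zero_of_mul this.ne', this⟩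

section main

variable {α : ℕ → SL(2, ℝ)} {γp γm tax : ℕ → ℝ}

lemma data_of (hnest : IsNestedSequence α γp γm tax)
    (hlen : ∀ n : ℕ, transLength (α n) ≤ ((1 : ℝ) / 2) ^ (2 * n + 3)) (n : ℕ) :
    Data (α n) (γp n) (γm n) (17 / 128 * (1 / 4) ^ n) := by
  have hp := hnest.plus_pos n
  have hm := hnest.minus_neg n
  have h4 : ((1 : ℝ) / 4) ^ n ≤ 1 := pow_le_one₀ (by norm_num) (by norm_num)
  have h40 : 0 < ((1 : ℝ) / 4) ^ n := by positivity
  refine ⟨(hnest.attracting n).1, (hnest.repelling n).1, hp, hm, ?_, by linarith⟩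
  have h1 := kappa_le (α n) (γp n) (γm n) (hnest.attracting n).1 (hnest.repelling n).1 (by linarith)
  have h2 : transLength (α n) / 2 ≤ 1 / 16 * (1 / 4) ^ n := by
    have := hlen n
    rw [pow_add, pow_mul] at this
    norm_num at this
    norm_num
    linarith
  have h3 := Real.sinh_le_sinh.2 h2
  have h5 := sinh_le_of (1 / 16 * (1 / 4) ^ n) (by positivity) (by linarith)
  nlinarith

lemma L_ge (hnest : IsNestedSequence α γp γm tax) (n : ℕ) : 2 ≤ γp n - γm n := by
  have hp := hnest.plus_pos n
  have hm := hnest.minus_neg n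
  have hc := (c_facts _ _ _ (hnest.attracting n) (hnest.repelling n) (by linarith)).1
  have ht := hnest.t_pos n
  have h1 := axis_eq (α n) (γp n) (γm n) (tax n) (hnest.attracting n).1 (hnest.repelling n).1 hp hm hc
    ((hnest.axis_meets n (tax n) ht.le).2 rfl)
  have h2 := Real.one_le_exp ht.le
  nlinarith [sq_nonneg (γp n + γm n)]

lemma L_mono (hnest : IsNestedSequence α γp γm tax) {i j : ℕ} (h : i ≤ j) :
    γp i - γm i ≤ γp j - γm j := by
  have h1 := hnest.plus_mono.monotone h
  have h2 := hnest.minus_anti.antitone h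
  linarith

lemma Z_bound (hnest : IsNestedSequence α γp γm tax)
    (hlen : ∀ n : ℕ, transLength (α n) ≤ ((1 : ℝ) / 2) ^ (2 * n + 3)) (n : ℕ) :
    ‖(Zs α n : ℂ)‖ ≤ (1 - 1 / 2 * (1 / 4) ^ n) * (γp n - γm n) := by
  induction n with
  | zero =>
    have := L_ge hnest 0
    have e : (Zs α 0 : ℂ) = Complex.I := rfl
    rw [e, Complex.norm_I]
    norm_num
    linarith
  | succ n ih =>
    have hL := L_ge hnest n
    have hL' := L_mono hnest (Nat.le_succ n)
    have h40 : 0 < ((1 : ℝ) / 4) ^ n := by positivity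
    have h4 : ((1 : ℝ) / 4) ^ n ≤ 1 := pow_le_one₀ (by norm_num) (by norm_num)
    have h1 := (data_of hnest hlen n).step (Zs α n) (ih.trans (by nlinarith))
    have h2 : ‖(Zs α (n + 1) : ℂ)‖ ≤ ‖((α n)⁻¹ • Zs α n : ℍ) - (Zs α n : ℂ)‖ + ‖(Zs α n : ℂ)‖ := by
      have := norm_add_le (((α n)⁻¹ • Zs α n : ℍ) - (Zs α n : ℂ)) (Zs α n : ℂ)
      rwa [sub_add_cancel] at this
    have h3 : ‖(Zs α (n + 1) : ℂ)‖ ≤ (1 - 1 / 8 * (1 / 4) ^ n) * (γp n - γm n) := by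
      nlinarith
    refine h3.trans ?_
    rw [pow_succ, Nat.succ_eq_add_one] at *
    have : (0 : ℝ) ≤ 1 - 1 / 8 * (1 / 4) ^ n := by linarith
    nlinarith

lemma Z_le (hnest : IsNestedSequence α γp γm tax)
    (hlen : ∀ n : ℕ, transLength (α n) ≤ ((1 : ℝ) / 2) ^ (2 * n + 3)) (n : ℕ) :
    ‖(Zs α n : ℂ)‖ ≤ γp n - γm n := by
  have h40 : 0 < ((1 : ℝ) / 4) ^ n := by positivity
  have hL := L_ge hnest n
  exact (Z_bound hnest hlen n).trans (by nlinarith)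

lemma Z_step (hnest : IsNestedSequence α γp γm tax)
    (hlen : ∀ n : ℕ, transLength (α n) ≤ ((1 : ℝ) / 2) ^ (2 * n + 3)) (n : ℕ) :
    ‖(Zs α (n + 1) : ℂ)‖ ≤ ‖(Zs α n : ℂ)‖ + 3 / 8 * (1 / 4) ^ n * (γp n - γm n) := by
  have h1 := (data_of hnest hlen n).step (Zs α n) (Z_le hnest hlen n)
  have h2 : ‖(Zs α (n + 1) : ℂ)‖ ≤ ‖((α n)⁻¹ • Zs α n : ℍ) - (Zs α n : ℂ)‖ + ‖(Zs α n : ℂ)‖ := by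
    have := norm_add_le (((α n)⁻¹ • Zs α n : ℍ) - (Zs α n : ℂ)) (Zs α n : ℂ)
    rwa [sub_add_cancel] at this
  linarith

lemma Z_im (hnest : IsNestedSequence α γp γm tax)
    (hlen : ∀ n : ℕ, transLength (α n) ≤ ((1 : ℝ) / 2) ^ (2 * n + 3)) (n : ℕ) :
    (Zs α n).im ≤ 4 - 3 * (1 / 4) ^ n := by
  induction n with
  | zero =>
    have e : (Zs α 0).im = 1 := UpperHalfPlane.I_im
    rw [e]; norm_num
  | succ n ih =>
    have h40 : 0 < ((1 : ℝ) / 4) ^ n := by positivity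
    have h1 := (data_of hnest hlen n).step_im (Zs α n) (Z_le hnest hlen n)
    have e : (Zs α (n + 1)).im = ((α n)⁻¹ • Zs α n).im := rfl
    rw [e, pow_succ]
    nlinarith

lemma Z_growth (hnest : IsNestedSequence α γp γm tax)
    (hlen : ∀ n : ℕ, transLength (α n) ≤ ((1 : ℝ) / 2) ^ (2 * n + 3)) (N n : ℕ) (h : N ≤ n) :
    ‖(Zs α (n + 1) : ℂ)‖ ≤ (γp N - γm N) +
      1 / 2 * ((1 / 4) ^ N - (1 / 4) ^ (n + 1)) * (γp n - γm n) := by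
  induction n, h using Nat.le_induction with
  | base =>
    have h1 := Z_step hnest hlen N
    have h2 := Z_le hnest hlen N
    rw [pow_succ]
    linarith
  | succ n hn ih =>
    have h1 := Z_step hnest hlen (n + 1)
    have hL := L_mono hnest (Nat.le_succ n)
    have h3 : ((1 : ℝ) / 4) ^ (n + 1) ≤ (1 / 4) ^ N :=
      pow_le_pow_of_le_one (by norm_num) (by norm_num) (by omega)
    have h4 : 1 / 2 * (((1 : ℝ) / 4) ^ N - (1 / 4) ^ (n + 1)) * (γp n - γm n) ≤
      1 / 2 * (((1 : ℝ) / 4) ^ N - (1 / 4) ^ (n + 1)) * (γp (n + 1) - γm (n + 1)) :=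
      mul_le_mul_of_nonneg_left hL (by linarith)
    rw [pow_succ _ (n + 1)]
    linarith

lemma vert (x t : ℝ) : dist (mkPt x (Real.exp t) (Real.exp_pos t)) (vray t) ≤ |x| / Real.exp t := by
  have h := Real.exp_pos t
  apply dist_le_of
  have e1 : (mkPt x (Real.exp t) (Real.exp_pos t) : ℂ) - (vray t : ℂ) = (x : ℂ) := by
    apply Complex.ext <;> simp [mkPt, vray]
  have e2 : (mkPt x (Real.exp t) (Real.exp_pos t)).im = Real.exp t := rfl
  have e3 : (vray t).im = Real.exp t := rfl
  have hne : Real.exp t ≠ 0 := Real.exp_ne_zero t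
  rw [e1, e2, e3, Real.sqrt_mul_self h.le, Complex.norm_real, Real.norm_eq_abs,
    div_mul_cancel₀ _ hne]

/-- the error function -/
def Err (α : ℕ → SL(2, ℝ)) (n : ℕ) (t : ℝ) (γ : SL(2, ℝ)) : ℝ :=
  dist (mkPt (Zs α (n + 1)).re (Real.exp t) (Real.exp_pos t)) (γ • vray t) +
  dist (mkPt (Zs α (n + 1)).re (Real.exp (t + 1)) (Real.exp_pos (t + 1))) (γ • vray (t + 1))

lemma Err_one (n : ℕ) (t : ℝ) : Err α n t 1 ≤ 2 * (‖(Zs α (n + 1) : ℂ)‖ / Real.exp t) := by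
  unfold Err
  rw [one_smul, one_smul]
  have h1 := vert (Zs α (n + 1)).re t
  have h2 := vert (Zs α (n + 1)).re (t + 1)
  have h3 : |(Zs α (n + 1)).re| ≤ ‖(Zs α (n + 1) : ℂ)‖ := Complex.abs_re_le_norm (Zs α (n + 1))
  have h4 : |(Zs α (n + 1)).re| / Real.exp t ≤ ‖(Zs α (n + 1) : ℂ)‖ / Real.exp t :=
    div_le_div_of_nonneg_right h3 (Real.exp_pos t).le
  have h5 : |(Zs α (n + 1)).re| / Real.exp (t + 1) ≤ ‖(Zs α (n + 1) : ℂ)‖ / Real.exp t :=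
    div_le_div₀ (norm_nonneg _) h3 (Real.exp_pos t) (Real.exp_le_exp.2 (by linarith))
  linarith

lemma Err_step (hnest : IsNestedSequence α γp γm tax)
    (hlen : ∀ n : ℕ, transLength (α n) ≤ ((1 : ℝ) / 2) ^ (2 * n + 3)) (n : ℕ) (t : ℝ)
    (ht : 0 ≤ t) (htL : Real.exp t ≤ γp (n + 1) - γm (n + 1)) (γ : SL(2, ℝ)) :
    Err α (n + 1) t ((α (n + 1))⁻¹ * γ) ≤ Err α n t γ + 87 * (1 / 4) ^ (n + 1) := by
  have D := data_of hnest hlen (n + 1)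
  have hz := Z_le hnest hlen (n + 1)
  have hi := Z_im hnest hlen (n + 1)
  have h40 : 0 < ((1 : ℝ) / 4) ^ (n + 1) := by positivity
  have h4 : ((1 : ℝ) / 4) ^ (n + 1) ≤ 1 / 4 := by
    have : ((1 : ℝ) / 4) ^ n ≤ 1 := pow_le_one₀ (by norm_num) (by norm_num)
    rw [pow_succ]; linarith
  have hs : Real.exp (t + 1) ≤ 3 * Real.exp t := by
    rw [Real.exp_add]
    nlinarith [Real.exp_one_lt_d9, Real.exp_pos t]
  have h0 := Real.one_le_exp ht
  have h01 := Real.one_le_exp (by linarith : 0 ≤ t + 1)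
  have c1 := D.compare (by linarith) (Zs α (n + 1)) hz (by linarith) (Real.exp t) h0
    (Real.exp_pos t) (by linarith)
  have c2 := D.compare (by linarith) (Zs α (n + 1)) hz (by linarith) (Real.exp (t + 1)) h01
    (Real.exp_pos (t + 1)) (by linarith)
  have tri : ∀ (P Q R : ℍ), dist P (((α (n + 1))⁻¹ * γ) • R) ≤
      dist P ((α (n + 1))⁻¹ • Q) + dist Q (γ • R) := by
    intro P Q R
    rw [mul_smul, ← dist_smul (α (n + 1))⁻¹ Q (γ • R)]
    exact dist_triangle _ _ _
  have t1 := tri (mkPt (Zs α (n + 1 + 1)).re (Real.exp t) (Real.exp_pos t))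
    (mkPt (Zs α (n + 1)).re (Real.exp t) (Real.exp_pos t)) (vray t)
  have t2 := tri (mkPt (Zs α (n + 1 + 1)).re (Real.exp (t + 1)) (Real.exp_pos (t + 1)))
    (mkPt (Zs α (n + 1)).re (Real.exp (t + 1)) (Real.exp_pos (t + 1))) (vray (t + 1))
  have e : Zs α (n + 1 + 1) = (α (n + 1))⁻¹ • Zs α (n + 1) := rfl
  unfold Err
  rw [e] at t1 t2 ⊢
  linarith

lemma exists_shadow (Γ : Subgroup SL(2, ℝ)) (hαΓ : ∀ n, α n ∈ Γ)
    (hnest : IsNestedSequence α γp γm tax)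
    (hlen : ∀ n : ℕ, transLength (α n) ≤ ((1 : ℝ) / 2) ^ (2 * n + 3)) (l : ℕ) :
    ∃ T : ℝ, 0 ≤ T ∧ ∀ n : ℕ, ∀ t : ℝ, T ≤ t → ∃ γ ∈ Γ, Err α n t γ ≤
      (∑ k ∈ Finset.range (n + 1), ((1 : ℝ) / 2) ^ k) * ((1 : ℝ) / 2) ^ l := by
  set N := l + 7 with hN
  have hLN := L_ge hnest N
  have h2l : (1 : ℝ) ≤ 2 ^ l := one_le_pow₀ (by norm_num)
  have hl2 : ((1 : ℝ) / 2) ^ l * 2 ^ l = 1 := by rw [← mul_pow]; norm_num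
  have hl0 : 0 < ((1 : ℝ) / 2) ^ l := by positivity
  have hsum : ∀ n : ℕ, (1 : ℝ) ≤ ∑ k ∈ Finset.range (n + 1), ((1 : ℝ) / 2) ^ k := by
    intro n
    have := Finset.single_le_sum (f := fun k => ((1 : ℝ) / 2) ^ k) (s := Finset.range (n + 1))
      (fun i _ => by positivity) (Finset.mem_range.2 (Nat.succ_pos n))
    simpa using this
  have hX : 1 ≤ 4 * 2 ^ l * (γp N - γm N) := by nlinarith
  refine ⟨Real.log (4 * 2 ^ l * (γp N - γm N)), Real.log_nonneg hX, ?_⟩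
  intro n t ht
  have ht0 : 0 ≤ t := (Real.log_nonneg hX).trans ht
  have hexp : 4 * 2 ^ l * (γp N - γm N) ≤ Real.exp t := by
    rwa [Real.log_le_iff_le_exp (by linarith)] at ht
  have hE := Real.exp_pos t
  have hexp' : 4 * (γp N - γm N) ≤ (1 / 2) ^ l * Real.exp t := by
    have := mul_le_mul_of_nonneg_left hexp hl0.le
    calc _ = ((1 : ℝ) / 2) ^ l * 2 ^ l * (4 * (γp N - γm N)) := by rw [hl2]; ring
      _ ≤ _ := by linarith
  have direct : ∀ n, ‖(Zs α (n + 1) : ℂ)‖ ≤ (1 / 2) ^ l / 2 * Real.exp t →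
      ∃ γ ∈ Γ, Err α n t γ ≤
      (∑ k ∈ Finset.range (n + 1), ((1 : ℝ) / 2) ^ k) * ((1 : ℝ) / 2) ^ l := by
    intro n hn
    refine ⟨1, Γ.one_mem, (Err_one n t).trans ?_⟩
    have h1 := hsum n
    have h2 : ‖(Zs α (n + 1) : ℂ)‖ / Real.exp t ≤ (1 / 2) ^ l / 2 := by
      rwa [div_le_iff₀ hE]
    nlinarith
  have small : ∀ n, n < N → ∃ γ ∈ Γ, Err α n t γ ≤
      (∑ k ∈ Finset.range (n + 1), ((1 : ℝ) / 2) ^ k) * ((1 : ℝ) / 2) ^ l := by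
    intro n hn
    apply direct
    have h1 := Z_le hnest hlen (n + 1)
    have h2 := L_mono hnest (Nat.succ_le_of_lt hn)
    simp only [Nat.succ_eq_add_one] at h2
    linarith
  induction n with
  | zero => exact small 0 (by omega)
  | succ n ih =>
    rcases lt_or_ge (n + 1) N with h | h
    · exact small _ h
    rcases le_total (γp (n + 1) - γm (n + 1)) (Real.exp t) with h1 | h1
    · apply direct
      have h2 := Z_growth hnest hlen N (n + 1) h
      have h3 : ((1 : ℝ) / 4) ^ N ≤ (1 / 2) ^ l / 2 := by
        have a1 : ((1 : ℝ) / 4) ^ l ≤ (1 / 2) ^ l := pow_le_pow_left₀ (by norm_num) (by norm_num) l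
        rw [hN, pow_add]
        norm_num at a1 ⊢
        linarith
      have h5 := L_ge hnest (n + 1)
      have h40 : 0 < ((1 : ℝ) / 4) ^ (n + 1 + 1) := by positivity
      have h6 : 1 / 2 * (((1 : ℝ) / 4) ^ N - (1 / 4) ^ (n + 1 + 1)) * (γp (n + 1) - γm (n + 1)) ≤
          (1 / 2) ^ l / 4 * Real.exp t := by
        refine mul_le_mul (by linarith) h1 (by linarith) (by positivity)
      linarith
    · obtain ⟨γ, hγ, hγ2⟩ := ih
      refine ⟨(α (n + 1))⁻¹ * γ, Γ.mul_mem (Γ.inv_mem (hαΓ _)) hγ, ?_⟩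
      refine (Err_step hnest hlen n t ht0 h1 γ).trans ?_
      rw [Finset.sum_range_succ, add_mul]
      have h2 : 87 * ((1 : ℝ) / 4) ^ (n + 1) ≤ (1 / 2) ^ (n + 1) * (1 / 2) ^ l := by
        have a1 : ((1 : ℝ) / 4) ^ (n + 1) = (1 / 2) ^ (n + 1) * (1 / 2) ^ (n + 1) := by
          rw [← mul_pow]; norm_num
        have a2 : ((1 : ℝ) / 2) ^ (n + 1) ≤ (1 / 2) ^ N :=
          pow_le_pow_of_le_one (by norm_num) (by norm_num) h
        have a3 : ((1 : ℝ) / 2) ^ N = (1 / 2) ^ l / 128 := by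
          rw [hN, pow_add]; norm_num; ring
        have a4 : 0 < ((1 : ℝ) / 2) ^ (n + 1) := by positivity
        rw [a1]
        nlinarith
      linarith

/-- `β_n ∞ ≠ ∞` -/
lemma den_seq (hnest : IsNestedSequence α γp γm tax) (n : ℕ) :
    (∀ x, γp n < x → seqProd α n 1 0 * x + seqProd α n 1 1 ≠ 0) ∧ seqProd α n 1 0 ≠ 0 := by
  have F : ∀ n, α n 1 0 ≠ 0 ∧ γp n < α n 0 0 / α n 1 0 ∧ ∀ x, γp n < x →
      α n 1 0 * x + α n 1 1 ≠ 0 ∧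
      γp n < (α n 0 0 * x + α n 0 1) / (α n 1 0 * x + α n 1 1) := by
    intro n
    have hp := hnest.plus_pos n
    have hm := hnest.minus_neg n
    obtain ⟨hc, hcμ⟩ := c_facts _ _ _ (hnest.attracting n) (hnest.repelling n) (by linarith)
    obtain ⟨h1, h2⟩ := coeffs (α n) _ _ (hnest.attracting n).1 (hnest.repelling n).1 (by linarith)
    have h3 := det_eq (α n)
    set μ := α n 1 0 * γp n + α n 1 1 with hμ
    have hμ0 : μ ≠ 0 := right_ne_zero_of_mul hcμ.ne'
    refine ⟨hc, ?_, ?_⟩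
    · have : α n 0 0 / α n 1 0 - γp n = 1 / (α n 1 0 * μ) := by
        rw [div_sub' hc, div_eq_div_iff hc hcμ.ne', hμ]
        linear_combination α n 1 0 * (h3 + α n 1 0 * h2 + α n 1 0 * γp n * h1)
      have : 0 < 1 / (α n 1 0 * μ) := by positivity
      linarith
    · intro x hx
      have hpos : 0 < (α n 1 0 * x + α n 1 1) * μ := by
        have : (α n 1 0 * x + α n 1 1) * μ = (α n 1 0 * μ) * (x - γp n) + μ ^ 2 := by
          rw [hμ]; ring
        rw [this]
        have : 0 < x - γp n := by linarith
        positivity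
      have hd : α n 1 0 * x + α n 1 1 ≠ 0 := left_ne_zero_of_mul hpos.ne'
      refine ⟨hd, ?_⟩
      have : (α n 0 0 * x + α n 0 1) / (α n 1 0 * x + α n 1 1) - γp n =
          (x - γp n) / ((α n 1 0 * x + α n 1 1) * μ) := by
        rw [div_sub' hd, div_eq_div_iff hd hpos.ne', hμ]
        have hf := (hnest.attracting n).1
        unfold IsFixedPt at hf
        linear_combination (α n 1 0 * x + α n 1 1) * ((x - γp n) * h3) -
          (α n 1 0 * x + α n 1 1) * (α n 1 0 * x + α n 1 1) * hf
      have : 0 < (x - γp n) / ((α n 1 0 * x + α n 1 1) * μ) := div_pos (by linarith) hpos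
      linarith
  induction n with
  | zero =>
    rw [seqProd_zero]
    exact ⟨fun x hx => ((F 0).2.2 x hx).1, (F 0).1⟩
  | succ n ih =>
    obtain ⟨f1, f2, f3⟩ := F (n + 1)
    have hmono : γp n < γp (n + 1) := hnest.plus_mono (Nat.lt_succ_self n)
    have e : ∀ j, seqProd α (n + 1) 1 j =
        seqProd α n 1 0 * α (n + 1) 0 j + seqProd α n 1 1 * α (n + 1) 1 j := by
      intro j
      rw [seqProd_succ, Matrix.SpecialLinearGroup.coe_mul, Matrix.mul_apply, Fin.sum_univ_two]
    constructor
    · intro x hx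
      obtain ⟨g1, g2⟩ := f3 x hx
      have h := mul_ne_zero (ih.1 _ (hmono.trans g2)) g1
      rw [e, e]
      intro h0
      apply h
      rw [add_mul, mul_assoc, div_mul_cancel₀ _ g1]
      linear_combination h0
    · have h := mul_ne_zero (ih.1 _ (hmono.trans f2)) f1
      rw [e]
      intro h0
      apply h
      rw [add_mul, mul_assoc, div_mul_cancel₀ _ f1]
      linear_combination h0

end main

lemma vray_coe (t : ℝ) : (vray t : ℂ) = (Real.exp t : ℂ) * Complex.I := by
  apply Complex.ext <;> simp [vray, -Complex.ofReal_exp]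

lemma endpoint (v : SL(2, ℝ)) (x : ℝ)
    (h : Tendsto (fun t : ℝ => ((v • vray t : ℍ) : ℂ)) atTop (nhds (x : ℂ))) :
    v 0 0 = x * v 1 0 := by
  have h1 : Tendsto (fun t : ℝ => ((Real.exp (-t) : ℝ) : ℂ)) atTop (nhds ((0 : ℝ) : ℂ)) :=
    (Complex.continuous_ofReal.tendsto 0).comp (Real.tendsto_exp_neg_atTop_nhds_zero)
  have h2 := h.mul ((tendsto_const_nhds (x := (v 1 0 : ℂ) * Complex.I)).add
    (h1.mul_const (v 1 1 : ℂ)))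
  have h3 := (tendsto_const_nhds (x := (v 0 0 : ℂ) * Complex.I)).add (h1.mul_const (v 0 1 : ℂ))
  have h4 : (fun t : ℝ => ((v • vray t : ℍ) : ℂ) * ((v 1 0 : ℂ) * Complex.I +
      ((Real.exp (-t) : ℝ) : ℂ) * (v 1 1 : ℂ))) =
      fun t : ℝ => (v 0 0 : ℂ) * Complex.I + ((Real.exp (-t) : ℝ) : ℂ) * (v 0 1 : ℂ) := by
    funext t
    have hd := den_ne v (vray t)
    have hE : ((Real.exp t : ℝ) : ℂ) * ((Real.exp (-t) : ℝ) : ℂ) = 1 := by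
      rw [← Complex.ofReal_mul, ← Real.exp_add]; simp
    rw [mob, div_mul_eq_mul_div, div_eq_iff hd, vray_coe]
    linear_combination (Complex.I * (v 0 0 * v 1 1 - v 0 1 * v 1 0)) * hE
  rw [h4] at h2
  have h5 := tendsto_nhds_unique h3 h2
  have h6 := congrArg Complex.im h5
  simpa using h6

lemma A_smul (t s : ℝ) : A t • vray s = vray (t + s) := by
  ext1
  rw [mob, vray_coe, vray_coe]
  have e1 : A t 0 0 = Real.exp (t / 2) := rfl
  have e2 : A t 0 1 = 0 := rfl
  have e3 : A t 1 0 = 0 := rfl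
  have e4 : A t 1 1 = Real.exp (-(t / 2)) := rfl
  rw [e1, e2, e3, e4]
  have h0 : ((Real.exp (-(t / 2)) : ℝ) : ℂ) ≠ 0 := by exact_mod_cast (Real.exp_pos _).ne'
  have h1 : Real.exp (t + s) * Real.exp (-(t / 2)) = Real.exp (t / 2) * Real.exp s := by
    rw [← Real.exp_add, ← Real.exp_add]; congr 1; ring
  have hexpC : ((Real.exp (t + s) : ℝ) : ℂ) * ((Real.exp (-(t / 2)) : ℝ) : ℂ) =
    ((Real.exp (t / 2) : ℝ) : ℂ) * ((Real.exp s : ℝ) : ℂ) := by exact_mod_cast h1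
  rw [Complex.ofReal_zero, zero_mul, zero_add, add_zero, div_eq_iff h0]
  linear_combination - Complex.I * hexpC

/-- upper triangular matrices act on the vertical ray -/
lemma upper (w : SL(2, ℝ)) (h : w 1 0 = 0) (s u : ℝ)
    (hs : s = - Real.log (w • (UpperHalfPlane.I : ℍ)).im + u) :
    w • vray s = mkPt (w • (UpperHalfPlane.I : ℍ)).re (Real.exp u) (Real.exp_pos u) := by
  have hdet := det_eq w
  rw [h, mul_zero, sub_zero] at hdet
  have h1 : (w 1 1) ≠ 0 := right_ne_zero_of_mul (hdet ▸ one_ne_zero)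
  have hg : ∀ z : ℍ, ((w • z : ℍ) : ℂ) = ((w 0 0 ^ 2 : ℝ) : ℂ) * z + ((w 0 0 * w 0 1 : ℝ) : ℂ) := by
    intro z
    have hdet' : (w 0 0 : ℂ) * w 1 1 = 1 := by exact_mod_cast hdet
    have h1' : (w 1 1 : ℂ) ≠ 0 := by exact_mod_cast h1
    rw [mob, h, Complex.ofReal_zero, zero_mul, zero_add, div_eq_iff h1']
    push_cast
    linear_combination - ((w 0 0 : ℂ) * z + w 0 1) * hdet'
  have hIre : (w • (UpperHalfPlane.I : ℍ)).re = w 0 0 * w 0 1 := by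
    rw [← coe_re, hg]
    simp [-Complex.ofReal_pow]
  have hIim : (w • (UpperHalfPlane.I : ℍ)).im = w 0 0 ^ 2 := by
    rw [← coe_im, hg]
    simp [-Complex.ofReal_pow]
  have hpos : 0 < w 0 0 ^ 2 := by
    have : w 0 0 ≠ 0 := left_ne_zero_of_mul (hdet ▸ one_ne_zero)
    positivity
  have hexp : w 0 0 ^ 2 * Real.exp s = Real.exp u := by
    rw [hs, hIim, Real.exp_add, Real.exp_neg, Real.exp_log hpos, ← mul_assoc,
      mul_inv_cancel₀ hpos.ne', one_mul]
  ext1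
  rw [hg, vray_coe]
  have e : (mkPt (w • (UpperHalfPlane.I : ℍ)).re (Real.exp u) (Real.exp_pos u) : ℂ) =
    ((w 0 0 * w 0 1 : ℝ) : ℂ) + ((Real.exp u : ℝ) : ℂ) * Complex.I := by
    rw [hIre]
    apply Complex.ext <;> simp [mkPt, -Complex.ofReal_exp]
  rw [e, ← hexp]
  push_cast
  ring

theorem shadowing_estimate
    (Γ : Subgroup SL(2, ℝ)) (hdisc : DiscreteTopology Γ)
    (htf : ∀ γ ∈ Γ, ∀ n : ℕ, 0 < n → γ ^ n = 1 → γ = 1)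
    (hneg : (-1 : SL(2, ℝ)) ∉ Γ)
    (α : ℕ → SL(2, ℝ)) (γp γm tax : ℕ → ℝ) (hnest : IsNestedSequence α γp γm tax)
    (hαΓ : ∀ n, α n ∈ Γ)
    (hlen : ∀ n : ℕ, transLength (α n) ≤ ((1 : ℝ) / 2) ^ (2 * n + 3))
    (v : ℕ → SL(2, ℝ)) (hv0 : ∀ n, v n • (UpperHalfPlane.I : ℍ) = UpperHalfPlane.I)
    (hvend : ∀ n, Tendsto (fun t : ℝ => ((v n • vray t : ℍ) : ℂ)) atTop
      (nhds ((seqProd α n 0 0 / seqProd α n 1 0 : ℝ) : ℂ))) :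
    ∀ l : ℕ, ∃ T : ℝ, 0 ≤ T ∧ ∀ n : ℕ, ∀ t : ℝ, T ≤ t →
      (⨅ γ : Γ, d1 (v n * A (busR α n + t)) ((γ : SL(2, ℝ)) * A t)) ≤
        (∑ k ∈ Finset.range (n + 1), ((1 : ℝ) / 2) ^ k) * ((1 : ℝ) / 2) ^ l := by
  intro l
  obtain ⟨T, hT, H⟩ := exists_shadow Γ hαΓ hnest hlen l
  refine ⟨T, hT, fun n t ht => ?_⟩
  obtain ⟨γ, hγ, hE⟩ := H n t ht
  set β := seqProd α n with hβ
  have hβΓ : β ∈ Γ := seqProd_mem Γ α hαΓ n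
  refine le_trans (ciInf_le ⟨0, ?_⟩ (⟨β * γ, Γ.mul_mem hβΓ hγ⟩ : Γ)) (le_trans (le_of_eq ?_) hE)
  · rintro _ ⟨γ', rfl⟩
    exact add_nonneg dist_nonneg dist_nonneg
  have hc : β 1 0 ≠ 0 := (den_seq hnest n).2
  have h1 := endpoint (v n) _ (hvend n)
  have hw10 : (β⁻¹ * v n) 1 0 = 0 := by
    obtain ⟨i1, i2, i3, i4⟩ := inv_entries β
    rw [Matrix.SpecialLinearGroup.coe_mul, Matrix.mul_apply, Fin.sum_univ_two]
    rw [i3, i4, h1, ← hβ]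
    field_simp
    ring
  have hwI : (β⁻¹ * v n) • (UpperHalfPlane.I : ℍ) = Zs α (n + 1) := by
    rw [mul_smul, hv0, hβ, Zs_eq]
  have hr : busR α n = - Real.log (Zs α (n + 1)).im := by
    unfold busR
    rw [Zs_eq]
  have key : ∀ s, dist ((v n * A (busR α n + t)) • vray s) ((β * γ * A t) • vray s) =
      dist (mkPt (Zs α (n + 1)).re (Real.exp (t + s)) (Real.exp_pos (t + s)))
        (γ • vray (t + s)) := by
    intro s
    rw [mul_smul, mul_smul, A_smul, A_smul, mul_smul, ← dist_smul β⁻¹, inv_smul_smul, ← mul_smul,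
      upper (β⁻¹ * v n) hw10 (busR α n + t + s) (t + s) (by rw [hwI, hr]; ring)]
    simp only [hwI]
  unfold d1 Err
  have k0 := key 0
  have k1 := key 1
  simp only [add_zero] at k0
  exact congrArg₂ (· + ·) k0 k1

end BellisFormal
end
end
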